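/- arXiv:2004.07020 — 4 statements merged into one kernel-verified Lean document; each statement's English description precedes it below -/
import Mathlib

section
/- Fix an integer r ≥ 1. There is a constant K > 0 and a threshold ρ₁ > 0 such that for every ε ∈ [0,1/2], all real numbers a, b, c with |c| + |a| + r|b| ≤ ε, and every ρ ∈ (0, ρ₁), the quantity N(ρ) := Σ_{l=1}^{r} Σ_{m=1}^{∞} Σ_{k=1}^{m} m·e^{−ρ(m + c + ak + mbl)} / (1 − e^{−ρ(m + c + ak + mbl)}) satisfies 2rζ(3)(1+ε)^{−3} ρ^{−3} − K ρ^{−2} ≤ N(ρ) ≤ 2rζ(3)(1−ε)^{−3} ρ^{−3} + K ρ^{−2}; in particular the constant K is independent of ε, a, b, c. -/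
open Filter Set Finset

/-- Apéry's constant ζ(3). -/
noncomputable def zeta3 : ℝ := ∑' k : ℕ, 1 / ((k : ℝ) + 1) ^ 3

/-- The saddle-point sum
N(ρ) = Σ_{l=1}^{r} Σ_{m=1}^{∞} Σ_{k=1}^{m} m e^{−ρ(m+c+ak+mbl)}/(1−e^{−ρ(m+c+ak+mbl)}),
the summation index m being shifted so that `m : ℕ` corresponds to m+1 ≥ 1. -/
noncomputable def saddleSum (r : ℕ) (a b c : ℝ) (ρ : ℝ) : ℝ :=
  ∑ l ∈ Finset.Icc 1 r, ∑' m : ℕ, ∑ k ∈ Finset.Icc 1 (m + 1),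
    ((m : ℝ) + 1) *
      Real.exp (-ρ * (((m : ℝ) + 1) + c + a * k + ((m : ℝ) + 1) * b * l)) /
      (1 - Real.exp (-ρ * (((m : ℝ) + 1) + c + a * k + ((m : ℝ) + 1) * b * l)))

theorem hasSum_succ_sq_mul_geometric {y : ℝ} (h0 : 0 ≤ y) (h1 : y < 1) :
    HasSum (fun m : ℕ => ((m : ℝ) + 1) ^ 2 * y ^ (m + 1)) (y * (1 + y) / (1 - y) ^ 3) := by
  have hy : ‖y‖ < 1 := by rwa [Real.norm_of_nonneg h0]
  have hne : 1 - y ≠ 0 := by linarith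
  have h := (((hasSum_choose_mul_geometric_of_norm_lt_one 2 hy).mul_left 2).sub
    (hasSum_choose_mul_geometric_of_norm_lt_one 1 hy)).mul_left y
  have hval : y * (1 + y) / (1 - y) ^ 3 =
      y * (2 * (1 / (1 - y) ^ (2 + 1)) - 1 / (1 - y) ^ (1 + 1)) := by
    field_simp
    ring
  rw [hval]
  refine h.congr_fun fun m => ?_
  rw [Nat.cast_choose_two, Nat.choose_one_right]
  push_cast
  ring

theorem Real.sinh_le_self_mul_cosh {v : ℝ} (hv : 0 ≤ v) : Real.sinh v ≤ v * Real.cosh v := by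
  have hmono : MonotoneOn (fun x : ℝ => x * Real.cosh x - Real.sinh x) (Set.Ici 0) := by
    apply monotoneOn_of_deriv_nonneg (convex_Ici 0)
    · fun_prop
    · fun_prop
    · intro x hx
      rw [interior_Ici] at hx
      have h : HasDerivAt (fun x : ℝ => x * Real.cosh x - Real.sinh x)
          (1 * Real.cosh x + x * Real.sinh x - Real.cosh x) x :=
        ((hasDerivAt_id x).mul (Real.hasDerivAt_cosh x)).sub (Real.hasDerivAt_sinh x)
      rw [h.deriv]
      have : 0 ≤ x * Real.sinh x :=
        mul_nonneg (le_of_lt hx) (Real.sinh_nonneg_iff.mpr (le_of_lt hx))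
      linarith
  have := hmono (Set.mem_Ici.mpr le_rfl) (Set.mem_Ici.mpr hv) hv
  simp at this
  linarith

theorem cosh_div_sinh_cube_le {v : ℝ} (hv : 0 < v) :
    Real.cosh v / Real.sinh v ^ 3 ≤ 1 / v ^ 3 + 1 / v ^ 2 := by
  have hs : v ≤ Real.sinh v := Real.self_le_sinh_iff.mpr hv.le
  have hs0 : 0 < Real.sinh v := hv.trans_le hs
  have hc : Real.cosh v ≤ 1 + Real.sinh v := by
    have h := Real.cosh_sub_sinh v
    have : Real.exp (-v) ≤ 1 := Real.exp_le_one_iff.mpr (by linarith)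
    linarith
  calc Real.cosh v / Real.sinh v ^ 3 ≤ (1 + Real.sinh v) / Real.sinh v ^ 3 := by gcongr
    _ = 1 / Real.sinh v ^ 3 + 1 / Real.sinh v ^ 2 := by field_simp
    _ ≤ _ := by gcongr

theorem le_cosh_div_sinh_cube {v : ℝ} (hv : 0 < v) :
    1 / v ^ 3 - 1 / v ^ 2 ≤ Real.cosh v / Real.sinh v ^ 3 := by
  have hs0 : 0 < Real.sinh v := Real.sinh_pos_iff.mpr hv
  have hc0 : 0 < Real.cosh v := Real.cosh_pos v
  have heq : 1 / v ^ 3 - 1 / v ^ 2 = (1 - v) / v ^ 3 := by field_simp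
  rw [heq]
  rcases le_total 1 v with h1 | h1
  · exact (div_nonpos_of_nonpos_of_nonneg (by linarith) (by positivity)).trans (by positivity)
  · have ht := Real.sinh_le_self_mul_cosh hv.le
    have hsq : Real.sinh v ^ 2 ≤ v ^ 2 * Real.cosh v ^ 2 := by
      rw [← mul_pow]; gcongr
    have hid := Real.cosh_sq v
    have key : (1 - v) * Real.cosh v ^ 2 ≤ 1 := by nlinarith [sq_nonneg (Real.cosh v)]
    calc (1 - v) / v ^ 3 = (1 - v) * Real.cosh v ^ 2 * Real.cosh v / (v * Real.cosh v) ^ 3 := by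
          field_simp
      _ ≤ 1 * Real.cosh v / (v * Real.cosh v) ^ 3 := by gcongr
      _ ≤ 1 * Real.cosh v / Real.sinh v ^ 3 := by gcongr
      _ = _ := by rw [one_mul]

theorem exp_neg_generating_eq_cosh_div_sinh_cube {v : ℝ} (hv : 0 < v) :
    Real.exp (-(2 * v)) * (1 + Real.exp (-(2 * v))) / (1 - Real.exp (-(2 * v))) ^ 3 =
      Real.cosh v / Real.sinh v ^ 3 / 4 := by
  have hs0 : 0 < Real.sinh v := Real.sinh_pos_iff.mpr hv
  have he : Real.exp (-v) * Real.exp v = 1 := by rw [← Real.exp_add]; simp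
  have h2 : Real.exp (-(2 * v)) = Real.exp (-v) ^ 2 := by
    rw [← Real.exp_nat_mul]; congr 1; push_cast; ring
  have h3 : 1 - Real.exp (-v) ^ 2 = 2 * Real.exp (-v) * Real.sinh v := by
    rw [Real.sinh_eq]; linear_combination -he
  have h4 : 1 + Real.exp (-v) ^ 2 = 2 * Real.exp (-v) * Real.cosh v := by
    rw [Real.cosh_eq]; linear_combination -he
  rw [h2, h3, h4]
  have := Real.exp_pos (-v)
  field_simp
  norm_num

theorem exp_neg_generating_bounds {u : ℝ} (hu : 0 < u) :
    2 / u ^ 3 - 1 / u ^ 2 ≤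
        Real.exp (-u) * (1 + Real.exp (-u)) / (1 - Real.exp (-u)) ^ 3 ∧
      Real.exp (-u) * (1 + Real.exp (-u)) / (1 - Real.exp (-u)) ^ 3 ≤
        2 / u ^ 3 + 1 / u ^ 2 := by
  obtain ⟨v, rfl⟩ : ∃ v, u = 2 * v := ⟨u / 2, by ring⟩
  have hv : 0 < v := by linarith
  rw [exp_neg_generating_eq_cosh_div_sinh_cube hv]
  have h1 := cosh_div_sinh_cube_le hv
  have h2 := le_cosh_div_sinh_cube hv
  have e3 : 2 / (2 * v) ^ 3 = 1 / v ^ 3 / 4 := by field_simp; norm_num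
  have e2 : 1 / (2 * v) ^ 2 = 1 / v ^ 2 / 4 := by field_simp; norm_num
  rw [e3, e2]
  constructor <;> linarith

theorem summable_one_div_succ_pow {p : ℕ} (hp : 1 < p) :
    Summable (fun j : ℕ => 1 / ((j : ℝ) + 1) ^ p) := by
  simpa using (summable_nat_add_iff 1).mpr (Real.summable_one_div_nat_pow.mpr hp)

theorem hasSum_exp_neg_geometric {x : ℝ} (hx : 0 < x) :
    HasSum (fun j : ℕ => Real.exp (-x) ^ (j + 1)) (Real.exp (-x) / (1 - Real.exp (-x))) := by
  have h := (hasSum_geometric_of_lt_one (Real.exp_pos (-x)).le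
    (Real.exp_lt_one_iff.mpr (by linarith))).mul_left (Real.exp (-x))
  simpa only [pow_succ', div_eq_mul_inv] using h

/-- The Lambert series `∑ m² / (e^{tm} - 1)` equals `2ζ(3)t⁻³` up to `O(t⁻²)`. -/
theorem lambert_sq_estimate {t : ℝ} (ht : 0 < t) :
    Summable (fun m : ℕ => ((m : ℝ) + 1) ^ 2 *
      (Real.exp (-(t * (m + 1))) / (1 - Real.exp (-(t * (m + 1)))))) ∧
    2 * zeta3 / t ^ 3 - (∑' j : ℕ, 1 / ((j : ℝ) + 1) ^ 2) / t ^ 2 ≤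
      ∑' m : ℕ, ((m : ℝ) + 1) ^ 2 *
        (Real.exp (-(t * (m + 1))) / (1 - Real.exp (-(t * (m + 1))))) ∧
    ∑' m : ℕ, ((m : ℝ) + 1) ^ 2 *
        (Real.exp (-(t * (m + 1))) / (1 - Real.exp (-(t * (m + 1))))) ≤
      2 * zeta3 / t ^ 3 + (∑' j : ℕ, 1 / ((j : ℝ) + 1) ^ 2) / t ^ 2 := by
  set F : ℕ × ℕ → ℝ := fun p => ((p.2 : ℝ) + 1) ^ 2 *
    Real.exp (-(t * (p.1 + 1))) ^ (p.2 + 1) with hF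
  set g : ℕ → ℝ := fun j => Real.exp (-(t * (j + 1))) * (1 + Real.exp (-(t * (j + 1)))) /
    (1 - Real.exp (-(t * (j + 1)))) ^ 3 with hg
  have hpos (j : ℕ) : 0 < t * ((j : ℝ) + 1) := by positivity
  have hrow (j : ℕ) : HasSum (fun m => F (j, m)) (g j) :=
    hasSum_succ_sq_mul_geometric (Real.exp_pos _).le
      (Real.exp_lt_one_iff.mpr (by linarith [hpos j]))
  have hcol (m : ℕ) : HasSum (fun j => F (j, m)) (((m : ℝ) + 1) ^ 2 *
      (Real.exp (-(t * (m + 1))) / (1 - Real.exp (-(t * (m + 1)))))) := by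
    refine ((hasSum_exp_neg_geometric (hpos m)).mul_left
      (((m : ℝ) + 1) ^ 2)).congr_fun fun j => ?_
    simp only [hF]
    rw [← Real.exp_nat_mul, ← Real.exp_nat_mul]
    congr 2
    push_cast
    ring
  have hs3 := (summable_one_div_succ_pow (p := 3) (by norm_num)).hasSum.mul_left (2 / t ^ 3)
  have hs2 := (summable_one_div_succ_pow (p := 2) (by norm_num)).hasSum.mul_left (1 / t ^ 2)
  have hb (j : ℕ) := exp_neg_generating_bounds (hpos j)
  have e3 (j : ℕ) : 2 / (t * ((j : ℝ) + 1)) ^ 3 = 2 / t ^ 3 * (1 / ((j : ℝ) + 1) ^ 3) := by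
    field_simp
  have e2 (j : ℕ) : 1 / (t * ((j : ℝ) + 1)) ^ 2 = 1 / t ^ 2 * (1 / ((j : ℝ) + 1) ^ 2) := by
    field_simp
  simp only [e3, e2] at hb
  have hF0 (p : ℕ × ℕ) : 0 ≤ F p := by positivity
  have hg0 (j : ℕ) : 0 ≤ g j := (hrow j).nonneg fun m => hF0 (j, m)
  have hgs : Summable g :=
    Summable.of_nonneg_of_le hg0 (fun j => (hb j).2) (hs3.add hs2).summable
  have hFs : Summable F := by
    rw [summable_prod_of_nonneg hF0]
    exact ⟨fun j => (hrow j).summable, hgs.congr fun j => ((hrow j).tsum_eq).symm⟩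
  have hcomm : ∑' m : ℕ, ((m : ℝ) + 1) ^ 2 *
      (Real.exp (-(t * (m + 1))) / (1 - Real.exp (-(t * (m + 1))))) = ∑' j, g j := by
    calc _ = ∑' m, ∑' j, F (j, m) := tsum_congr fun m => ((hcol m).tsum_eq).symm
      _ = ∑' j, ∑' m, F (j, m) := Summable.tsum_comm (f := fun j m => F (j, m)) hFs
      _ = _ := tsum_congr fun j => (hrow j).tsum_eq
  have hz : 2 * zeta3 / t ^ 3 = 2 / t ^ 3 * ∑' j : ℕ, 1 / ((j : ℝ) + 1) ^ 3 := by
    rw [zeta3]; ring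
  have hz2 : (∑' j : ℕ, 1 / ((j : ℝ) + 1) ^ 2) / t ^ 2 =
      1 / t ^ 2 * ∑' j : ℕ, 1 / ((j : ℝ) + 1) ^ 2 := by ring
  refine ⟨?_, ?_, ?_⟩
  · exact (hFs.prod_symm.prod).congr fun m => (hcol m).tsum_eq
  · rw [hcomm, hz, hz2]
    exact hasSum_le (fun j => (hb j).1) (hs3.sub hs2) hgs.hasSum
  · rw [hcomm, hz, hz2]
    exact hasSum_le (fun j => (hb j).2) hgs.hasSum (hs3.add hs2)

theorem exp_neg_div_one_sub_anti {x y : ℝ} (hx : 0 < x) (hxy : x ≤ y) :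
    Real.exp (-y) / (1 - Real.exp (-y)) ≤ Real.exp (-x) / (1 - Real.exp (-x)) := by
  have h1 : Real.exp (-y) ≤ Real.exp (-x) := Real.exp_le_exp.mpr (by linarith)
  have h2 : Real.exp (-x) < 1 := Real.exp_lt_one_iff.mpr (by linarith)
  exact div_le_div₀ (Real.exp_pos _).le h1 (by linarith) (by linarith)

theorem abs_perturbation_le {r : ℕ} {ε a b c M k l : ℝ} (h : |c| + |a| + r * |b| ≤ ε)
    (hM : 1 ≤ M) (hk0 : 0 ≤ k) (hk : k ≤ M) (hl0 : 0 ≤ l) (hl : l ≤ r) :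
    |c + a * k + M * b * l| ≤ ε * M := by
  calc |c + a * k + M * b * l| ≤ |c| + |a * k| + |M * b * l| := abs_add_three _ _ _
    _ = |c| * 1 + |a| * k + l * |b| * M := by
        rw [abs_mul, abs_mul, abs_mul, abs_of_nonneg hk0, abs_of_nonneg hl0,
          abs_of_nonneg (zero_le_one.trans hM)]
        ring
    _ ≤ |c| * M + |a| * M + r * |b| * M := by gcongr
    _ = (|c| + |a| + r * |b|) * M := by ring
    _ ≤ ε * M := by gcongr

theorem saddleSum_inner_bounds {r l : ℕ} {ε a b c ρ : ℝ} (hε : ε < 1)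
    (h : |c| + |a| + r * |b| ≤ ε) (hρ : 0 < ρ) (hl : l ≤ r) (m : ℕ) :
    ((m : ℝ) + 1) ^ 2 * (Real.exp (-((1 + ε) * ρ * (m + 1))) /
        (1 - Real.exp (-((1 + ε) * ρ * (m + 1))))) ≤
      ∑ k ∈ Finset.Icc 1 (m + 1), ((m : ℝ) + 1) *
        Real.exp (-ρ * (((m : ℝ) + 1) + c + a * k + ((m : ℝ) + 1) * b * l)) /
        (1 - Real.exp (-ρ * (((m : ℝ) + 1) + c + a * k + ((m : ℝ) + 1) * b * l))) ∧
    ∑ k ∈ Finset.Icc 1 (m + 1), ((m : ℝ) + 1) *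
        Real.exp (-ρ * (((m : ℝ) + 1) + c + a * k + ((m : ℝ) + 1) * b * l)) /
        (1 - Real.exp (-ρ * (((m : ℝ) + 1) + c + a * k + ((m : ℝ) + 1) * b * l))) ≤
      ((m : ℝ) + 1) ^ 2 * (Real.exp (-((1 - ε) * ρ * (m + 1))) /
        (1 - Real.exp (-((1 - ε) * ρ * (m + 1))))) := by
  have hM : (1 : ℝ) ≤ (m : ℝ) + 1 := by simp
  have hconst (s : ℝ) : ((m : ℝ) + 1) ^ 2 * s =
      ∑ k ∈ Finset.Icc 1 (m + 1), ((m : ℝ) + 1) * s := by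
    simp
    ring
  have hbd (k : ℕ) (hk : k ∈ Finset.Icc 1 (m + 1)) :
      |c + a * k + ((m : ℝ) + 1) * b * l| ≤ ε * ((m : ℝ) + 1) := by
    have hk2 := (Finset.mem_Icc.mp hk).2
    exact abs_perturbation_le h hM k.cast_nonneg (by exact_mod_cast hk2) l.cast_nonneg
      (by exact_mod_cast hl)
  have hp : 0 < (1 - ε) * ρ * ((m : ℝ) + 1) :=
    mul_pos (mul_pos (by linarith) hρ) (by linarith)
  rw [hconst, hconst]
  constructor <;> refine Finset.sum_le_sum fun k hk => ?_
  all_goals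
    have hlo : (1 - ε) * ρ * ((m : ℝ) + 1) ≤
        ρ * (((m : ℝ) + 1) + c + a * k + ((m : ℝ) + 1) * b * l) := by
      nlinarith [(abs_le.mp (hbd k hk)).1]
    have hhi : ρ * (((m : ℝ) + 1) + c + a * k + ((m : ℝ) + 1) * b * l) ≤
        (1 + ε) * ρ * ((m : ℝ) + 1) := by
      nlinarith [(abs_le.mp (hbd k hk)).2]
    rw [neg_mul, mul_div_assoc]
    refine mul_le_mul_of_nonneg_left ?_ (by linarith)
  · exact exp_neg_div_one_sub_anti (hp.trans_le hlo) hhi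
  · exact exp_neg_div_one_sub_anti hp hlo

/- STATEMENT 4 (Lemma 4.2): there are K > 0 and ρ₁ > 0, with K independent of
ε, a, b, c, such that for every ε ∈ [0,1/2], all a, b, c with |c|+|a|+r|b| ≤ ε
and every ρ ∈ (0,ρ₁):
2rζ(3)(1+ε)^{−3}ρ^{−3} − Kρ^{−2} ≤ N(ρ) ≤ 2rζ(3)(1−ε)^{−3}ρ^{−3} + Kρ^{−2}. -/
theorem saddle_sum_two_sided_estimate (r : ℕ) (hr : 1 ≤ r) :
    ∃ K > (0 : ℝ), ∃ ρ₁ > (0 : ℝ),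
      ∀ ε ∈ Set.Icc (0 : ℝ) (1 / 2), ∀ a b c : ℝ,
        |c| + |a| + r * |b| ≤ ε → ∀ ρ ∈ Set.Ioo (0 : ℝ) ρ₁,
          2 * r * zeta3 / (1 + ε) ^ 3 * ρ ^ (-3 : ℤ) - K * ρ ^ (-2 : ℤ)
              ≤ saddleSum r a b c ρ ∧
            saddleSum r a b c ρ
              ≤ 2 * r * zeta3 / (1 - ε) ^ 3 * ρ ^ (-3 : ℤ) + K * ρ ^ (-2 : ℤ) := by
  have hZ0 : 0 < ∑' j : ℕ, 1 / ((j : ℝ) + 1) ^ 2 :=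
    (summable_one_div_succ_pow (p := 2) (by norm_num)).tsum_pos
      (fun j => by positivity) 0 (by norm_num)
  have hr0 : (0 : ℝ) < r := by exact_mod_cast hr
  refine ⟨r * (4 * ∑' j : ℕ, 1 / ((j : ℝ) + 1) ^ 2), by positivity, 1, one_pos, ?_⟩
  rintro ε ⟨hε0, hε1⟩ a b c h ρ ⟨hρ, -⟩
  set Z := ∑' j : ℕ, 1 / ((j : ℝ) + 1) ^ 2
  obtain ⟨hsl, hlo, -⟩ := lambert_sq_estimate (t := (1 + ε) * ρ) (by positivity)
  obtain ⟨hsu, -, hhi⟩ :=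
    lambert_sq_estimate (t := (1 - ε) * ρ) (mul_pos (by linarith) hρ)
  have hin (l : ℕ) (hl : l ∈ Finset.Icc 1 r) (m : ℕ) :=
    saddleSum_inner_bounds (by linarith) h hρ (Finset.mem_Icc.mp hl).2 m
  have hsum (l : ℕ) (hl : l ∈ Finset.Icc 1 r) := Summable.of_nonneg_of_le
    (fun m => le_trans (mul_nonneg (sq_nonneg _) (div_nonneg (Real.exp_pos _).le
      (sub_nonneg.mpr (Real.exp_le_one_iff.mpr (neg_nonpos.mpr (by positivity))))))
      (hin l hl m).1) (fun m => (hin l hl m).2) hsu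
  have hconst (s : ℝ) : ∑ l ∈ Finset.Icc 1 r, s = r * s := by simp
  have hZlo : Z / ((1 + ε) * ρ) ^ 2 ≤ 4 * Z / ρ ^ 2 := by
    gcongr
    · linarith
    · nlinarith
  have hZhi : Z / ((1 - ε) * ρ) ^ 2 ≤ 4 * Z / ρ ^ 2 := by
    have : 4 * Z / ρ ^ 2 = Z / (1 / 2 * ρ) ^ 2 := by field_simp; norm_num
    rw [this]
    gcongr
    linarith
  have hz3 : ρ ^ (-3 : ℤ) = 1 / ρ ^ 3 := by rw [zpow_neg, one_div]; rfl
  have hz2 : ρ ^ (-2 : ℤ) = 1 / ρ ^ 2 := by rw [zpow_neg, one_div]; rfl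
  rw [hz3, hz2]
  constructor
  · have heq : 2 * r * zeta3 / (1 + ε) ^ 3 * (1 / ρ ^ 3) - r * (4 * Z) * (1 / ρ ^ 2) =
        r * (2 * zeta3 / ((1 + ε) * ρ) ^ 3 - 4 * Z / ρ ^ 2) := by
      field_simp
    rw [heq, ← hconst]
    exact Finset.sum_le_sum fun l hl => ((sub_le_sub_left hZlo _).trans hlo).trans
      (hsl.tsum_le_tsum (fun m => (hin l hl m).1) (hsum l hl))
  · have heq : 2 * r * zeta3 / (1 - ε) ^ 3 * (1 / ρ ^ 3) + r * (4 * Z) * (1 / ρ ^ 2) =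
        r * (2 * zeta3 / ((1 - ε) * ρ) ^ 3 + 4 * Z / ρ ^ 2) := by
      have hne : 1 - ε ≠ 0 := by linarith
      field_simp
    rw [heq, ← hconst]
    exact Finset.sum_le_sum fun l hl => ((hsum l hl).tsum_le_tsum
      (fun m => (hin l hl m).2) hsu).trans (hhi.trans (add_le_add_right hZhi _))
end

section
/- As ρ → 0⁺ one has Σ_{m=1}^{∞} m² e^{−ρm}/(1 − e^{−ρm}) = 2ζ(3) ρ^{−3} − (1/12) ρ^{−1} + O(1), i.e. there exist constants C, ρ₁ > 0 such that for all ρ ∈ (0, ρ₁) the absolute value of the difference between the left-hand side and 2ζ(3)ρ^{−3} − ρ^{−1}/12 is at most C. -/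
open Filter Set

/-- The function `x ↦ 1 / (exp x - 1)`. -/
noncomputable def bose (x : ℝ) : ℝ := (Real.exp x - 1)⁻¹

/-- The analytic continuation of `x ↦ 1 / (exp x - 1) - 1 / x` to the real line. -/
noncomputable def boseReg : ℝ → ℝ := dslope (fun x => (dslope Real.exp 0 x)⁻¹) 0

lemma dslope_exp_zero_of_ne {x : ℝ} (hx : x ≠ 0) :
    dslope Real.exp 0 x = (Real.exp x - 1) / x := by
  rw [dslope_of_ne _ hx, slope_def_field]; simp

lemma dslope_exp_zero_zero : dslope Real.exp 0 0 = 1 := by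
  simp [dslope_same]

lemma exp_sub_one_ne_zero {x : ℝ} (hx : x ≠ 0) : Real.exp x - 1 ≠ 0 := by
  rw [sub_ne_zero]; simpa using hx

lemma boseReg_of_ne {x : ℝ} (hx : x ≠ 0) : boseReg x = bose x - 1 / x := by
  have h := exp_sub_one_ne_zero hx
  rw [boseReg, dslope_of_ne _ hx, slope_def_field, dslope_exp_zero_of_ne hx,
    dslope_exp_zero_zero, bose]
  field_simp
  ring

lemma AnalyticAt.dslope_self {f : ℝ → ℝ} {a : ℝ} (hf : AnalyticAt ℝ f a) :
    AnalyticAt ℝ (dslope f a) a := by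
  obtain ⟨p, hp⟩ := hf
  exact ⟨_, hp.has_fpower_series_dslope_fslope⟩

lemma analyticAt_bose {x : ℝ} (hx : x ≠ 0) : AnalyticAt ℝ bose x := by
  have h := exp_sub_one_ne_zero hx
  have h1 : AnalyticAt ℝ (fun y : ℝ => Real.exp y - 1) x := by fun_prop
  exact h1.inv h

lemma analyticAt_boseReg (x : ℝ) : AnalyticAt ℝ boseReg x := by
  rcases eq_or_ne x 0 with rfl | hx
  · refine AnalyticAt.dslope_self (AnalyticAt.inv (AnalyticAt.dslope_self ?_) ?_)
    · fun_prop
    · rw [dslope_exp_zero_zero]; exact one_ne_zero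
  · have h1 : AnalyticAt ℝ (fun y : ℝ => bose y - 1 / y) x :=
      (analyticAt_bose hx).sub (analyticAt_const.div analyticAt_id hx)
    refine h1.congr ?_
    filter_upwards [isOpen_ne.mem_nhds hx] with y hy
    exact (boseReg_of_ne hy).symm

lemma hasDerivAt_bose {x : ℝ} (hx : x ≠ 0) : HasDerivAt bose (-(bose x + bose x ^ 2)) x := by
  have h := exp_sub_one_ne_zero hx
  have h1 := ((Real.hasDerivAt_exp x).sub_const 1).inv h
  refine h1.congr_deriv ?_
  rw [bose]
  field_simp
  ring

lemma deriv_boseReg {x : ℝ} (hx : x ≠ 0) :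
    deriv boseReg x = -(bose x + bose x ^ 2) + 1 / x ^ 2 := by
  have h1 : HasDerivAt (fun y : ℝ => bose y - y⁻¹) (-(bose x + bose x ^ 2) - -(x ^ 2)⁻¹) x :=
    (hasDerivAt_bose hx).sub (hasDerivAt_inv hx)
  have h2 : boseReg =ᶠ[nhds x] fun y : ℝ => bose y - y⁻¹ := by
    filter_upwards [isOpen_ne.mem_nhds hx] with y hy
    rw [boseReg_of_ne hy, one_div]
  rw [h2.deriv_eq, h1.deriv]
  ring

lemma deriv_deriv_boseReg {x : ℝ} (hx : x ≠ 0) :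
    deriv (deriv boseReg) x = (1 + 2 * bose x) * (bose x + bose x ^ 2) - 2 / x ^ 3 := by
  have hb := hasDerivAt_bose hx
  have h1 := ((hb.add (hb.pow 2)).neg).add ((hasDerivAt_pow 2 x).inv (pow_ne_zero 2 hx))
  have h2 : deriv boseReg =ᶠ[nhds x]
      (-(bose + bose ^ 2) + (fun y : ℝ => y ^ 2)⁻¹) := by
    filter_upwards [isOpen_ne.mem_nhds hx] with y hy
    rw [deriv_boseReg hy]
    simp
  rw [h2.deriv_eq, h1.deriv]
  field_simp
  ring

lemma deriv_deriv_deriv_boseReg {x : ℝ} (hx : x ≠ 0) :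
    deriv (deriv (deriv boseReg)) x =
      -((1 + 6 * bose x + 6 * bose x ^ 2) * (bose x + bose x ^ 2)) + 6 / x ^ 4 := by
  have hb := hasDerivAt_bose hx
  have h1 := (((hb.const_mul 2).const_add 1).mul (hb.add (hb.pow 2))).sub
    (((hasDerivAt_pow 3 x).inv (pow_ne_zero 3 hx)).const_mul 2)
  have h2 : deriv (deriv boseReg) =ᶠ[nhds x] ((fun y => 1 + 2 * bose y) * (bose + bose ^ 2) -
      fun y => 2 * (fun z : ℝ => z ^ 3)⁻¹ y) := by
    filter_upwards [isOpen_ne.mem_nhds hx] with y hy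
    rw [deriv_deriv_boseReg hy, div_eq_mul_inv]
    rfl
  rw [h2.deriv_eq]
  refine h1.deriv.trans ?_
  simp only [Pi.add_apply, Pi.pow_apply]
  field_simp
  ring

lemma boseReg_riccati (x : ℝ) :
    x * deriv boseReg x = -(x * boseReg x) - 1 - x * boseReg x ^ 2 - 2 * boseReg x := by
  have hc : Continuous boseReg :=
    continuous_iff_continuousAt.2 fun x => (analyticAt_boseReg x).continuousAt
  have hc' : Continuous (deriv boseReg) :=
    continuous_iff_continuousAt.2 fun x => (analyticAt_boseReg x).deriv.continuousAt
  have key := Continuous.ext_on (s := {0}ᶜ) (dense_compl_singleton (0 : ℝ))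
    (f := fun x => x * deriv boseReg x)
    (g := fun x => -(x * boseReg x) - 1 - x * boseReg x ^ 2 - 2 * boseReg x)
    (by fun_prop) (by fun_prop) (by
      intro y hy
      have hy : y ≠ 0 := hy
      simp only [deriv_boseReg hy, boseReg_of_ne hy]
      field_simp
      ring)
  exact congrFun key x

lemma deriv_boseReg_zero : deriv boseReg 0 = 1 / 12 := by
  have h0 : boseReg 0 = -1 / 2 := by
    have := boseReg_riccati 0
    linarith
  have hB := (analyticAt_boseReg 0).differentiableAt.hasDerivAt
  have hB' := (analyticAt_boseReg 0).deriv.differentiableAt.hasDerivAt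
  have hl := (hasDerivAt_id (0 : ℝ)).mul hB'
  have hr := ((((hasDerivAt_id (0 : ℝ)).mul hB).neg.sub_const 1).sub
    ((hasDerivAt_id (0 : ℝ)).mul (hB.pow 2))).sub (hB.const_mul 2)
  have := hl.unique (hr.congr_of_eventuallyEq (Eventually.of_forall boseReg_riccati))
  simp [h0] at this
  linarith

lemma bose_pos {x : ℝ} (hx : 0 < x) : 0 < bose x :=
  inv_pos.2 (sub_pos.2 (Real.one_lt_exp_iff.2 hx))

lemma bose_le {x : ℝ} (hx : 0 < x) : bose x ≤ 2 / x ^ 2 := by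
  have h := Real.quadratic_le_exp_of_nonneg hx.le
  rw [bose, inv_le_comm₀ (by linarith [Real.one_lt_exp_iff.2 hx]) (by positivity), inv_div]
  linarith

lemma exists_abs_deriv_deriv_deriv_boseReg_le :
    ∃ C > 0, ∀ x, 0 ≤ x → |deriv (deriv (deriv boseReg)) x| ≤ C / (1 + x) ^ 2 := by
  have hc : ContinuousOn (deriv (deriv (deriv boseReg))) (Icc 0 1) := fun x _ =>
    (analyticAt_boseReg x).deriv.deriv.deriv.continuousAt.continuousWithinAt
  obtain ⟨M, hM⟩ := isCompact_Icc.exists_bound_of_continuousOn hc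
  refine ⟨max (4 * M) 912, by positivity, fun x hx => ?_⟩
  rw [le_div_iff₀ (by positivity)]
  rcases le_total x 1 with h1 | h1
  · have h2 := hM x ⟨hx, h1⟩
    rw [Real.norm_eq_abs] at h2
    refine le_trans ?_ (le_max_left _ _)
    have h3 : (1 + x) ^ 2 ≤ 4 := by nlinarith
    calc _ ≤ M * 4 := mul_le_mul h2 h3 (by positivity) ((abs_nonneg _).trans h2)
      _ = 4 * M := by ring
  · refine le_trans ?_ (le_max_right _ _)
    have hx0 : 0 < x := by linarith
    have hb := bose_pos hx0
    have hb1 := bose_le hx0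
    have hx2 : 1 ≤ x ^ 2 := by nlinarith
    have hb2 : bose x ≤ 2 := hb1.trans (by rw [div_le_iff₀ (by positivity)]; linarith)
    have h4 : 6 / x ^ 4 ≤ 6 / x ^ 2 := by
      gcongr
      norm_num
    have h5 : (1 + 6 * bose x + 6 * bose x ^ 2) * (bose x + bose x ^ 2) ≤ 37 * (3 * bose x) := by
      apply mul_le_mul <;> nlinarith
    have h6 : |deriv (deriv (deriv boseReg)) x| ≤ 228 / x ^ 2 := by
      rw [deriv_deriv_deriv_boseReg hx0.ne']
      have h7 : 0 ≤ (1 + 6 * bose x + 6 * bose x ^ 2) * (bose x + bose x ^ 2) := by positivity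
      have h8 : 0 ≤ 6 / x ^ 4 := by positivity
      have h9 : 37 * (3 * (2 / x ^ 2)) + 6 / x ^ 2 = 228 / x ^ 2 := by ring
      rw [abs_le]
      constructor <;> linarith
    calc _ ≤ 228 / x ^ 2 * (1 + x) ^ 2 := by gcongr
      _ ≤ 228 / x ^ 2 * (4 * x ^ 2) := by gcongr; nlinarith
      _ = 912 := by field_simp; norm_num

lemma tendsto_deriv_boseReg_atTop : Tendsto (deriv boseReg) atTop (nhds 0) := by
  have hb : Tendsto bose atTop (nhds 0) :=
    tendsto_inv_atTop_zero.comp (tendsto_atTop_add_const_right _ (-1) Real.tendsto_exp_atTop)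
  have hx : Tendsto (fun x : ℝ => x⁻¹) atTop (nhds 0) := tendsto_inv_atTop_zero
  have h := ((hb.add (hb.pow 2)).neg).add (hx.pow 2)
  norm_num at h
  refine h.congr' ?_
  filter_upwards [eventually_ne_atTop 0] with x hx
  rw [deriv_boseReg hx]
  field_simp
  ring

/-- A one-step rectangle rule with error controlled by a bound on the second derivative. -/
lemma abs_sub_sub_mul_le {G : ℝ → ℝ} (hG : Differentiable ℝ G) (hG' : Differentiable ℝ (deriv G))
    {a b K : ℝ} (hab : a ≤ b) (hK : ∀ x ∈ Icc a b, |deriv (deriv G) x| ≤ K) :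
    |G b - G a - (b - a) * deriv G b| ≤ K * (b - a) ^ 2 := by
  have hK0 : 0 ≤ K := (abs_nonneg _).trans (hK a ⟨le_rfl, hab⟩)
  have ha : a ∈ Icc a b := ⟨le_rfl, hab⟩
  have hb : b ∈ Icc a b := ⟨hab, le_rfl⟩
  have h1 : ∀ x ∈ Icc a b, |deriv G x - deriv G b| ≤ K * (b - a) := by
    intro x hx
    have := (convex_Icc a b).norm_image_sub_le_of_norm_deriv_le (f := deriv G)
      (fun y _ => hG' y) hK hb hx
    refine this.trans ?_
    gcongr
    rw [Real.norm_eq_abs, abs_le]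
    constructor <;> linarith [hx.1, hx.2]
  have hd : ∀ x, HasDerivAt (fun y => G y - y * deriv G b) (deriv G x - deriv G b) x := by
    intro x
    have h := (hG x).hasDerivAt.sub ((hasDerivAt_id x).mul_const (deriv G b))
    rw [one_mul] at h
    exact h
  have h2 := (convex_Icc a b).norm_image_sub_le_of_norm_hasDerivWithin_le
    (fun x _ => (hd x).hasDerivWithinAt) h1 ha hb
  rw [Real.norm_eq_abs, Real.norm_eq_abs, abs_of_nonneg (sub_nonneg.2 hab)] at h2
  calc _ = |G b - b * deriv G b - (G a - a * deriv G b)| := by congr 1; ring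
    _ ≤ _ := h2
    _ = _ := by ring

/-- Riemann sums of `deriv G` approximate the increment of `G` to first order in the mesh. -/
lemma abs_riemann_sum_sub_le {G : ℝ → ℝ} (hG : Differentiable ℝ G)
    (hG' : Differentiable ℝ (deriv G)) {C : ℝ} (hC0 : 0 ≤ C)
    (hC : ∀ x, 0 ≤ x → |deriv (deriv G) x| ≤ C / (1 + x) ^ 2) {ρ : ℝ} (hρ : 0 < ρ) (N : ℕ) :
    |G (ρ * N) - G 0 - ρ * ∑ k ∈ Finset.range N, deriv G (ρ * (k + 1))| ≤ C * (1 + ρ) * ρ := by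
  suffices h : |G (ρ * N) - G 0 - ρ * ∑ k ∈ Finset.range N, deriv G (ρ * (k + 1))| ≤
      C * (1 + ρ) * ρ * (1 - 1 / (1 + ρ * N)) by
    refine h.trans (mul_le_of_le_one_right (by positivity) ?_)
    have : 0 ≤ 1 / (1 + ρ * N) := by positivity
    linarith
  induction N with
  | zero => simp
  | succ n ih =>
    have h1 := abs_sub_sub_mul_le hG hG' (a := ρ * n) (b := ρ * (n + 1))
      (K := C / (1 + ρ * n) ^ 2) (by nlinarith) (by
        intro x hx
        have h0 : 0 ≤ ρ * n := by positivity
        refine (hC x (h0.trans hx.1)).trans ?_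
        gcongr
        exact hx.1)
    have h2 : C / (1 + ρ * n) ^ 2 * (ρ * (n + 1) - ρ * n) ^ 2 ≤
        C * (1 + ρ) * ρ * (1 / (1 + ρ * n) - 1 / (1 + ρ * (n + 1))) := by
      have e1 : C * (1 + ρ) * ρ * (1 / (1 + ρ * n) - 1 / (1 + ρ * (n + 1))) =
          C * ρ ^ 2 * ((1 + ρ) / ((1 + ρ * n) * (1 + ρ * (n + 1)))) := by
        field_simp
        ring
      have e2 : C / (1 + ρ * n) ^ 2 * (ρ * (n + 1) - ρ * n) ^ 2 =
          C * ρ ^ 2 * (1 / (1 + ρ * n) ^ 2) := by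
        field_simp
        ring
      rw [e1, e2]
      refine mul_le_mul_of_nonneg_left ?_ (by positivity)
      rw [div_le_div_iff₀ (by positivity) (by positivity)]
      have : 0 ≤ ρ * n * ρ * (1 + ρ * n) := by positivity
      nlinarith
    rw [Finset.sum_range_succ]
    push_cast
    calc _ = |(G (ρ * n) - G 0 - ρ * ∑ k ∈ Finset.range n, deriv G (ρ * (k + 1))) +
          (G (ρ * (n + 1)) - G (ρ * n) -
            (ρ * (n + 1) - ρ * n) * deriv G (ρ * (n + 1)))| := by congr 1; ring
      _ ≤ _ := abs_add_le _ _
      _ ≤ _ := add_le_add ih (h1.trans h2)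
      _ = _ := by ring

lemma hasSum_sq_mul_geometric {q : ℝ} (h0 : 0 ≤ q) (h1 : q < 1) :
    HasSum (fun m : ℕ => ((m : ℝ) + 1) ^ 2 * q ^ (m + 1)) (q * (1 + q) / (1 - q) ^ 3) := by
  have hq : ‖q‖ < 1 := by rwa [Real.norm_of_nonneg h0]
  have hs2 := (hasSum_choose_mul_geometric_of_norm_lt_one 2 hq).mul_left (2 * q)
  have hs1 := (hasSum_choose_mul_geometric_of_norm_lt_one 1 hq).mul_left q
  have h := hs2.sub hs1
  have hne : 1 - q ≠ 0 := by linarith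
  have e : q * (1 + q) / (1 - q) ^ 3 =
      2 * q * (1 / (1 - q) ^ (2 + 1)) - q * (1 / (1 - q) ^ (1 + 1)) := by
    field_simp
    ring
  rw [e]
  refine h.congr_fun fun m => ?_
  have : (((m + 2 : ℕ).choose 2 : ℕ) : ℝ) = (m + 2) * (m + 1) / 2 := by
    rw [Nat.cast_choose_two]; push_cast; ring
  rw [this, Nat.choose_one_right]
  push_cast
  ring

lemma bose_eq {x : ℝ} (hx : 0 < x) :
    (1 + 2 * bose x) * (bose x + bose x ^ 2) =
      Real.exp (-x) * (1 + Real.exp (-x)) / (1 - Real.exp (-x)) ^ 3 := by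
  have h := exp_sub_one_ne_zero hx.ne'
  have h2 := Real.exp_pos x
  have h3 : 1 - Real.exp (-x) = (Real.exp x - 1) / Real.exp x := by
    rw [Real.exp_neg]; field_simp
  rw [h3, Real.exp_neg, bose]
  field_simp
  ring

lemma exp_pow_eq (ρ : ℝ) (m k : ℕ) :
    Real.exp (-(ρ * (k + 1))) ^ (m + 1) = Real.exp (-ρ * (m + 1)) ^ (k + 1) := by
  rw [← Real.exp_nat_mul, ← Real.exp_nat_mul]
  push_cast
  ring_nf

/-- Summing the Lambert series by columns. -/
lemma hasSum_lambert {ρ : ℝ} (hρ : 0 < ρ) :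
    HasSum (fun k : ℕ => (1 + 2 * bose (ρ * (k + 1))) *
        (bose (ρ * (k + 1)) + bose (ρ * (k + 1)) ^ 2))
      (∑' m : ℕ, ((m : ℝ) + 1) ^ 2 * Real.exp (-ρ * ((m : ℝ) + 1)) /
            (1 - Real.exp (-ρ * ((m : ℝ) + 1)))) := by
  have hrow : ∀ k : ℕ, HasSum
      (fun m : ℕ => ((m : ℝ) + 1) ^ 2 * Real.exp (-(ρ * (k + 1))) ^ (m + 1))
      ((1 + 2 * bose (ρ * (k + 1))) * (bose (ρ * (k + 1)) + bose (ρ * (k + 1)) ^ 2)) := by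
    intro k
    have hk : 0 < ρ * ((k : ℝ) + 1) := by positivity
    rw [bose_eq hk]
    exact hasSum_sq_mul_geometric (Real.exp_pos _).le (Real.exp_lt_one_iff.2 (by linarith))
  have hcol : ∀ m : ℕ, HasSum
      (fun k : ℕ => ((m : ℝ) + 1) ^ 2 * Real.exp (-(ρ * (k + 1))) ^ (m + 1))
      (((m : ℝ) + 1) ^ 2 * Real.exp (-ρ * ((m : ℝ) + 1)) /
            (1 - Real.exp (-ρ * ((m : ℝ) + 1)))) := by
    intro m
    have hm : 0 < ρ * ((m : ℝ) + 1) := by positivity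
    have h := (hasSum_geometric_of_lt_one (Real.exp_pos (-ρ * ((m : ℝ) + 1))).le
      (Real.exp_lt_one_iff.2 (by linarith))).mul_left
        (((m : ℝ) + 1) ^ 2 * Real.exp (-ρ * ((m : ℝ) + 1)))
    rw [div_eq_mul_inv]
    refine h.congr_fun ?_
    intro k
    rw [exp_pow_eq, pow_succ']
    ring
  have hlt : Real.exp (-ρ) < 1 := Real.exp_lt_one_iff.2 (by linarith)
  have hsum : Summable (fun k : ℕ => (1 + 2 * bose (ρ * (k + 1))) *
        (bose (ρ * (k + 1)) + bose (ρ * (k + 1)) ^ 2)) := by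
    have hg := (summable_geometric_of_lt_one (Real.exp_pos (-ρ)).le hlt).mul_left
      (2 / (1 - Real.exp (-ρ)) ^ 3)
    refine Summable.of_nonneg_of_le (fun k => ?_) (fun k => ?_) hg
    · have := bose_pos (x := ρ * ((k : ℝ) + 1)) (by positivity)
      positivity
    · have hk : 0 < ρ * ((k : ℝ) + 1) := by positivity
      have hk' : ρ ≤ ρ * ((k : ℝ) + 1) := by nlinarith [mul_nonneg hρ.le k.cast_nonneg (α := ℝ)]
      have hle : Real.exp (-(ρ * ((k : ℝ) + 1))) ≤ Real.exp (-ρ) :=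
        Real.exp_le_exp.2 (by linarith)
      have hle' : Real.exp (-(ρ * ((k : ℝ) + 1))) ≤ Real.exp (-ρ) ^ k := by
        rw [← Real.exp_nat_mul]
        exact Real.exp_le_exp.2 (by linarith)
      rw [bose_eq hk]
      calc _ ≤ Real.exp (-ρ) ^ k * (1 + 1) / (1 - Real.exp (-ρ)) ^ 3 := by
            have : 0 < 1 - Real.exp (-ρ) := by linarith
            gcongr
            exact hle.trans hlt.le
        _ = _ := by ring
  have hprod : Summable (fun p : ℕ × ℕ =>
      ((p.2 : ℝ) + 1) ^ 2 * Real.exp (-(ρ * (p.1 + 1))) ^ (p.2 + 1)) := by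
    rw [summable_prod_of_nonneg (fun p => by positivity)]
    refine ⟨fun k => (hrow k).summable, ?_⟩
    simpa only [(hrow _).tsum_eq] using hsum
  have hcomm := hprod.tsum_comm
    (f := fun k m : ℕ => ((m : ℝ) + 1) ^ 2 * Real.exp (-(ρ * (k + 1))) ^ (m + 1))
  simp only [(hrow _).tsum_eq, (hcol _).tsum_eq] at hcomm
  rw [hcomm]
  exact hsum.hasSum

lemma hasSum_deriv_deriv_boseReg {ρ : ℝ} (hρ : 0 < ρ) :
    HasSum (fun k : ℕ => deriv (deriv boseReg) (ρ * (k + 1)))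
      ((∑' m : ℕ, ((m : ℝ) + 1) ^ 2 * Real.exp (-ρ * ((m : ℝ) + 1)) /
            (1 - Real.exp (-ρ * ((m : ℝ) + 1)))) - 2 * zeta3 * ρ ^ (-3 : ℤ)) := by
  have hz : Summable (fun k : ℕ => 1 / ((k : ℝ) + 1) ^ 3) := by
    have := (summable_nat_add_iff 1).2 (Real.summable_one_div_nat_pow.2 (by norm_num : 1 < 3))
    simpa using this
  have h := (hasSum_lambert hρ).sub (hz.hasSum.mul_left (2 * ρ ^ (-3 : ℤ)))
  have e : 2 * zeta3 * ρ ^ (-3 : ℤ) = 2 * ρ ^ (-3 : ℤ) * ∑' k : ℕ, 1 / ((k : ℝ) + 1) ^ 3 := by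
    rw [zeta3]; ring
  rw [e]
  refine h.congr_fun fun k => ?_
  have hk : 0 < ρ * ((k : ℝ) + 1) := by positivity
  rw [deriv_deriv_boseReg hk.ne']
  congr 1
  rw [zpow_neg, zpow_ofNat]
  field_simp

/- STATEMENT 7: as ρ → 0⁺,
Σ_{m≥1} m² e^{−ρm}/(1−e^{−ρm}) = 2ζ(3)ρ^{−3} − (1/12)ρ^{−1} + O(1):
there exist C, ρ₁ > 0 such that for all ρ ∈ (0,ρ₁) the difference is at most C
in absolute value.  The summation index m is shifted so that `m : ℕ` corresponds
to m+1 ≥ 1. -/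
theorem saddle_sum_asymptotic_expansion :
    ∃ C > (0 : ℝ), ∃ ρ₁ > (0 : ℝ), ∀ ρ ∈ Set.Ioo (0 : ℝ) ρ₁,
      |(∑' m : ℕ, ((m : ℝ) + 1) ^ 2 * Real.exp (-ρ * ((m : ℝ) + 1)) /
            (1 - Real.exp (-ρ * ((m : ℝ) + 1))))
          - (2 * zeta3 * ρ ^ (-3 : ℤ) - ρ⁻¹ / 12)| ≤ C := by
  obtain ⟨C, hC0, hC⟩ := exists_abs_deriv_deriv_deriv_boseReg_le
  refine ⟨2 * C, by positivity, 1, one_pos, ?_⟩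
  rintro ρ ⟨hρ, hρ1⟩
  have hs := hasSum_deriv_deriv_boseReg hρ
  set S := ∑' m : ℕ, ((m : ℝ) + 1) ^ 2 * Real.exp (-ρ * ((m : ℝ) + 1)) /
            (1 - Real.exp (-ρ * ((m : ℝ) + 1)))
  have hT : Tendsto (fun N : ℕ => ρ * (N : ℝ)) atTop atTop :=
    tendsto_natCast_atTop_atTop.const_mul_atTop hρ
  have hlim := ((((tendsto_deriv_boseReg_atTop.comp hT).sub_const (deriv boseReg 0)).sub
    (hs.tendsto_sum_nat.const_mul ρ))).abs
  have hle := le_of_tendsto' hlim fun N => abs_riemann_sum_sub_le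
    (fun x => (analyticAt_boseReg x).deriv.differentiableAt)
    (fun x => (analyticAt_boseReg x).deriv.deriv.differentiableAt) hC0.le hC hρ N
  rw [deriv_boseReg_zero] at hle
  have e : 0 - 1 / 12 - ρ * (S - 2 * zeta3 * ρ ^ (-3 : ℤ)) =
      -(ρ * (S - (2 * zeta3 * ρ ^ (-3 : ℤ) - ρ⁻¹ / 12))) := by
    have := mul_inv_cancel₀ hρ.ne'
    linear_combination (1 / 12) * this
  rw [e, abs_neg, abs_mul, abs_of_pos hρ, mul_comm] at hle
  refine (le_of_mul_le_mul_right hle hρ).trans ?_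
  nlinarith
end

section
/- Fix an integer r ≥ 1, and for each integer n ≥ 1 let ρ₀ = ρ₀(n) be the unique positive real number satisfying n = r · Σ_{m=1}^{∞} m² e^{−ρ₀ m}/(1 − e^{−ρ₀ m}). Then as n → ∞ one has ρ₀^{−1} = n^{1/3}/(2rζ(3))^{1/3} + O(n^{−1/3}). -/
open Filter Set

/-- For `0 < s`, the function `1 / s ^ 3 - cosh s / sinh s ^ 3` is bounded near `0`. -/
lemma abs_inv_cube_sub_cosh_div_sinh_cube_le_one {s : ℝ} (hs : 0 < s) (hs1 : s ≤ 1) :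
    |1 / s ^ 3 - Real.cosh s / Real.sinh s ^ 3| ≤ 1 := by
  have hsa : |s| = s := abs_of_pos hs
  have h1 := Real.exp_bound (x := s) (by rwa [hsa]) (n := 5) (by norm_num)
  have h2 := Real.exp_bound (x := -s) (by rwa [abs_neg, hsa]) (n := 5) (by norm_num)
  rw [abs_neg] at h2
  simp only [hsa, Finset.sum_range_succ, Finset.sum_range_zero, Nat.factorial] at h1 h2
  norm_num at h1 h2
  rw [abs_le] at h1 h2
  have hsinh := Real.sinh_eq s
  have hcosh := Real.cosh_eq s
  obtain ⟨w, hw⟩ : ∃ w, Real.sinh s = s * (1 + s ^ 2 / 6 + w) :=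
    ⟨Real.sinh s / s - (1 + s ^ 2 / 6), by field_simp; ring⟩
  obtain ⟨b, hb⟩ : ∃ b, Real.cosh s = 1 + s ^ 2 / 2 + b := ⟨Real.cosh s - (1 + s ^ 2 / 2), by ring⟩
  have h5 : s ^ 5 ≤ s ^ 4 := pow_le_pow_of_le_one hs.le hs1 (by norm_num)
  have hw' : |w| ≤ s ^ 4 / 100 := by
    have : |s * w| ≤ s * (s ^ 4 / 100) := by
      rw [abs_le]; constructor <;> nlinarith
    rw [abs_mul, hsa] at this
    exact le_of_mul_le_mul_left this hs
  have hb' : |b| ≤ s ^ 4 / 10 := by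
    have h4 : 0 < s ^ 4 := by positivity
    rw [abs_le]; constructor <;> linarith
  have hu1 : s ^ 2 ≤ 1 := pow_le_one₀ hs.le hs1
  have hu0 : 0 < s ^ 2 := by positivity
  have h42 : s ^ 4 = (s ^ 2) ^ 2 := by ring
  have hv : |s ^ 2 / 6 + w| ≤ s ^ 2 / 5 := by
    rw [abs_le] at hw' ⊢; constructor <;> nlinarith
  have hs_le : s ≤ Real.sinh s := Real.self_le_sinh_iff.2 hs.le
  have hsinh_pos : 0 < Real.sinh s := hs.trans_le hs_le
  have key : |Real.sinh s ^ 3 - s ^ 3 * Real.cosh s| ≤ s ^ 6 := by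
    have e : Real.sinh s ^ 3 - s ^ 3 * Real.cosh s
        = s ^ 3 * (3 * (s ^ 2 / 6 + w) ^ 2 + (s ^ 2 / 6 + w) ^ 3 + 3 * w - b) := by
      rw [hw, hb]; ring
    have hv2 : (s ^ 2 / 6 + w) ^ 2 ≤ s ^ 4 / 25 := by
      rw [← sq_abs]
      calc |s ^ 2 / 6 + w| ^ 2 ≤ (s ^ 2 / 5) ^ 2 := by gcongr
        _ = _ := by ring
    have hv3 : |(s ^ 2 / 6 + w) ^ 3| ≤ s ^ 4 / 25 := by
      rw [abs_pow]
      calc |s ^ 2 / 6 + w| ^ 3 ≤ (s ^ 2 / 5) ^ 3 := by gcongr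
        _ ≤ _ := by nlinarith [pow_pos hs 4]
    have h4 : s ^ 4 ≤ s ^ 3 := pow_le_pow_of_le_one hs.le hs1 (by norm_num)
    have : |3 * (s ^ 2 / 6 + w) ^ 2 + (s ^ 2 / 6 + w) ^ 3 + 3 * w - b| ≤ s ^ 3 := by
      have := sq_nonneg (s ^ 2 / 6 + w)
      rw [abs_le] at hv3 hw' hb' ⊢
      constructor <;> linarith [pow_pos hs 4]
    rw [e, abs_mul, abs_of_pos (by positivity : 0 < s ^ 3)]
    calc s ^ 3 * _ ≤ s ^ 3 * s ^ 3 := by gcongr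
      _ = _ := by ring
  rw [div_sub_div _ _ (by positivity) (by positivity), abs_div, one_mul,
    abs_of_pos (by positivity : 0 < s ^ 3 * Real.sinh s ^ 3), div_le_one (by positivity)]
  calc _ ≤ s ^ 6 := key
    _ = s ^ 3 * s ^ 3 := by ring
    _ ≤ _ := by gcongr

lemma abs_inv_cube_sub_cosh_div_sinh_cube_le_inv_sq {s : ℝ} (hs : 1 ≤ s) :
    |1 / s ^ 3 - Real.cosh s / Real.sinh s ^ 3| ≤ 2 / s ^ 2 := by
  have hs0 : 0 < s := by linarith
  have hs_le : s ≤ Real.sinh s := Real.self_le_sinh_iff.2 hs0.le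
  have hsinh_pos : 0 < Real.sinh s := hs0.trans_le hs_le
  have hcosh : Real.cosh s ≤ 2 * Real.sinh s := by
    have h1 := Real.add_one_le_exp (2 * s)
    have h2 : Real.exp s = Real.exp (2 * s) * Real.exp (-s) := by
      rw [← Real.exp_add]; congr 1; ring
    have h3 := Real.exp_pos (-s)
    rw [Real.cosh_eq, Real.sinh_eq]
    nlinarith
  have ha : 0 < 1 / s ^ 3 := by positivity
  have hb : 0 < Real.cosh s / Real.sinh s ^ 3 := by have := Real.cosh_pos s; positivity
  have ha' : 1 / s ^ 3 ≤ 2 / s ^ 2 := by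
    rw [div_le_div_iff₀ (by positivity) (by positivity)]
    nlinarith [pow_pos hs0 2]
  have hb' : Real.cosh s / Real.sinh s ^ 3 ≤ 2 / s ^ 2 := by
    calc Real.cosh s / Real.sinh s ^ 3 ≤ 2 * Real.sinh s / Real.sinh s ^ 3 := by gcongr
      _ = 2 / Real.sinh s ^ 2 := by field_simp
      _ ≤ _ := by gcongr
  rw [abs_le]; constructor <;> linarith

lemma hasSum_succ_sq_mul_pow_succ {x : ℝ} (hx0 : 0 ≤ x) (hx1 : x < 1) :
    HasSum (fun m : ℕ => ((m : ℝ) + 1) ^ 2 * x ^ (m + 1)) (x * (1 + x) / (1 - x) ^ 3) := by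
  have hx : ‖x‖ < 1 := by rwa [Real.norm_of_nonneg hx0]
  have h2 := hasSum_choose_mul_geometric_of_norm_lt_one 2 hx
  have h1 := hasSum_choose_mul_geometric_of_norm_lt_one 1 hx
  have h := ((h2.mul_left 2).sub h1).mul_left x
  have hne : 1 - x ≠ 0 := by linarith
  have e : x * (1 + x) / (1 - x) ^ 3
      = x * (2 * (1 / (1 - x) ^ (2 + 1)) - 1 / (1 - x) ^ (1 + 1)) := by
    field_simp
    ring
  rw [e]
  refine h.congr_fun fun m => ?_
  rw [Nat.cast_choose_two, Nat.choose_one_right]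
  push_cast
  ring

lemma abs_two_div_cube_sub_exp_le {t : ℝ} (ht : 0 < t) :
    |2 / t ^ 3 - Real.exp (-t) * (1 + Real.exp (-t)) / (1 - Real.exp (-t)) ^ 3|
      ≤ 9 / 2 / (1 + t) ^ 2 := by
  obtain ⟨s, rfl⟩ : ∃ s, t = 2 * s := ⟨t / 2, by ring⟩
  have hs : 0 < s := by linarith
  have e : 2 / (2 * s) ^ 3 - Real.exp (-(2 * s)) * (1 + Real.exp (-(2 * s))) /
      (1 - Real.exp (-(2 * s))) ^ 3 = 1 / 4 * (1 / s ^ 3 - Real.cosh s / Real.sinh s ^ 3) := by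
    have hy := Real.exp_pos s
    have hy1 : 1 < Real.exp s := Real.one_lt_exp_iff.2 hs
    have e1 : Real.exp (-(2 * s)) = (Real.exp s ^ 2)⁻¹ := by
      rw [Real.exp_neg, ← Real.exp_nat_mul]; norm_num
    rw [e1, Real.cosh_eq, Real.sinh_eq, Real.exp_neg]
    generalize Real.exp s = y at *
    have hne : y ^ 2 - 1 ≠ 0 := by nlinarith
    have h1 : 1 - (y ^ 2)⁻¹ = (y ^ 2 - 1) / y ^ 2 := by field_simp
    have h2 : (y - y⁻¹) / 2 = (y ^ 2 - 1) / (2 * y) := by field_simp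
    rw [h1, h2]
    field_simp
    ring
  rw [e, abs_mul, abs_of_pos (by norm_num : (0 : ℝ) < 1 / 4), le_div_iff₀ (by positivity)]
  rcases le_total s 1 with h | h
  · have := abs_inv_cube_sub_cosh_div_sinh_cube_le_one hs h
    have h9 : (1 + 2 * s) ^ 2 ≤ 9 := by nlinarith
    calc _ ≤ 1 / 4 * 1 * (9 : ℝ) := by gcongr
      _ ≤ _ := by norm_num
  · have := abs_inv_cube_sub_cosh_div_sinh_cube_le_inv_sq h
    have h9 : (1 + 2 * s) ^ 2 ≤ 9 * s ^ 2 := by nlinarith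
    calc _ ≤ 1 / 4 * (2 / s ^ 2) * (9 * s ^ 2) := by gcongr
      _ = _ := by field_simp; norm_num

lemma summable_inv_one_add_mul_sq {ρ : ℝ} (hρ : 0 < ρ) :
    Summable (fun k : ℕ => 1 / (1 + ρ * ((k : ℝ) + 1)) ^ 2) ∧
      ∑' k : ℕ, 1 / (1 + ρ * ((k : ℝ) + 1)) ^ 2 ≤ 1 / ρ := by
  have hnn : ∀ k : ℕ, 0 ≤ 1 / (1 + ρ * ((k : ℝ) + 1)) ^ 2 := fun k => by positivity
  have hb : ∀ n : ℕ, ∑ k ∈ Finset.range n, 1 / (1 + ρ * ((k : ℝ) + 1)) ^ 2 ≤ 1 / ρ := by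
    intro n
    have hn : ∑ k ∈ Finset.range n, 1 / (1 + ρ * ((k : ℝ) + 1)) ^ 2
        ≤ 1 / ρ - 1 / ρ * (1 / (1 + ρ * n)) := by
      induction n with
      | zero => simp
      | succ n ih =>
        rw [Finset.sum_range_succ]
        have : 1 / (1 + ρ * ((n : ℝ) + 1)) ^ 2
            ≤ 1 / ρ * (1 / (1 + ρ * n)) - 1 / ρ * (1 / (1 + ρ * ((n : ℝ) + 1))) := by
          calc 1 / (1 + ρ * ((n : ℝ) + 1)) ^ 2
              ≤ 1 / ((1 + ρ * n) * (1 + ρ * ((n : ℝ) + 1))) := by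
                rw [sq]; gcongr; linarith
            _ = _ := by field_simp; ring
        push_cast
        linarith
    have : 0 ≤ 1 / ρ * (1 / (1 + ρ * n)) := by positivity
    linarith
  exact ⟨summable_of_sum_range_le hnn hb, Real.tsum_le_of_sum_range_le hnn hb⟩

lemma hasSum_zeta3 : HasSum (fun k : ℕ => 1 / ((k : ℝ) + 1) ^ 3) zeta3 := by
  have h : Summable fun k : ℕ => 1 / ((k : ℝ) + 1) ^ 3 := by
    simpa using (summable_nat_add_iff 1).2 (Real.summable_one_div_nat_pow.2 (by norm_num : 1 < 3))
  exact h.hasSum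

lemma zeta3_pos : 0 < zeta3 :=
  hasSum_zeta3.summable.tsum_pos (fun _ => by positivity) 0 (by norm_num)

lemma tsum_sq_mul_exp_div_eq {ρ : ℝ} (hρ : 0 < ρ)
    (hs : Summable fun k : ℕ => Real.exp (-(ρ * ((k : ℝ) + 1))) *
      (1 + Real.exp (-(ρ * ((k : ℝ) + 1)))) / (1 - Real.exp (-(ρ * ((k : ℝ) + 1)))) ^ 3) :
    ∑' m : ℕ, ((m : ℝ) + 1) ^ 2 * Real.exp (-ρ * ((m : ℝ) + 1)) /
        (1 - Real.exp (-ρ * ((m : ℝ) + 1))) =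
      ∑' k : ℕ, Real.exp (-(ρ * ((k : ℝ) + 1))) * (1 + Real.exp (-(ρ * ((k : ℝ) + 1)))) /
        (1 - Real.exp (-(ρ * ((k : ℝ) + 1)))) ^ 3 := by
  have hlt : ∀ k : ℕ, Real.exp (-(ρ * ((k : ℝ) + 1))) < 1 := fun k =>
    Real.exp_lt_one_iff.2 (neg_neg_of_pos (by positivity))
  have hk := fun k : ℕ => hasSum_succ_sq_mul_pow_succ (Real.exp_pos _).le (hlt k)
  have hprod : Summable (Function.uncurry fun k m : ℕ =>
      ((m : ℝ) + 1) ^ 2 * Real.exp (-(ρ * ((k : ℝ) + 1))) ^ (m + 1)) := by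
    refine (summable_prod_of_nonneg fun p => ?_).2 ⟨fun k => (hk k).summable, ?_⟩
    · simp only [Function.uncurry, Pi.zero_apply]; positivity
    · simpa only [Function.uncurry, (hk _).tsum_eq] using hs
  simp_rw [← (hk _).tsum_eq]
  rw [← hprod.tsum_comm]
  refine tsum_congr fun m => ?_
  have hx := hlt m
  have hx0 := Real.exp_pos (-(ρ * ((m : ℝ) + 1)))
  have hg := (hasSum_geometric_of_lt_one hx0.le hx).mul_left
    (((m : ℝ) + 1) ^ 2 * Real.exp (-(ρ * ((m : ℝ) + 1))))
  rw [neg_mul, div_eq_mul_inv, ← hg.tsum_eq]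
  refine tsum_congr fun k => ?_
  rw [mul_assoc, ← pow_succ', ← Real.exp_nat_mul, ← Real.exp_nat_mul]
  push_cast
  ring_nf

/-- The Lambert-type series `∑ m² e^{-ρm} / (1 - e^{-ρm})` is `2ζ(3) / ρ³ + O(1 / ρ)`,
uniformly in `ρ > 0`. -/
lemma abs_tsum_sq_mul_exp_div_sub_le {ρ : ℝ} (hρ : 0 < ρ) :
    |∑' m : ℕ, ((m : ℝ) + 1) ^ 2 * Real.exp (-ρ * ((m : ℝ) + 1)) /
        (1 - Real.exp (-ρ * ((m : ℝ) + 1))) - 2 * zeta3 / ρ ^ 3| ≤ 9 / 2 / ρ := by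
  set G : ℕ → ℝ := fun k => Real.exp (-(ρ * ((k : ℝ) + 1))) *
    (1 + Real.exp (-(ρ * ((k : ℝ) + 1)))) / (1 - Real.exp (-(ρ * ((k : ℝ) + 1)))) ^ 3 with hG
  have hz : HasSum (fun k : ℕ => 2 / (ρ * ((k : ℝ) + 1)) ^ 3) (2 * zeta3 / ρ ^ 3) := by
    have h := hasSum_zeta3.mul_left (2 / ρ ^ 3)
    rw [div_mul_eq_mul_div] at h
    simpa only [mul_pow, div_mul_div_comm, mul_one] using h
  obtain ⟨hS, hSle⟩ := summable_inv_one_add_mul_sq hρ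
  have hbound : ∀ k : ℕ, ‖2 / (ρ * ((k : ℝ) + 1)) ^ 3 - G k‖
      ≤ 9 / 2 * (1 / (1 + ρ * ((k : ℝ) + 1)) ^ 2) := fun k => by
    rw [mul_one_div]
    exact abs_two_div_cube_sub_exp_le (by positivity)
  have hdiff := Summable.of_norm_bounded (hS.mul_left (9 / 2)) hbound
  have hGs : Summable G := by simpa using hz.summable.sub hdiff
  rw [tsum_sq_mul_exp_div_eq hρ hGs, ← hz.tsum_eq, abs_sub_comm,
    ← hz.summable.tsum_sub hGs]
  calc _ ≤ ∑' k : ℕ, 9 / 2 * (1 / (1 + ρ * ((k : ℝ) + 1)) ^ 2) :=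
        tsum_of_norm_bounded (hS.mul_left (9 / 2)).hasSum hbound
    _ = 9 / 2 * ∑' k : ℕ, 1 / (1 + ρ * ((k : ℝ) + 1)) ^ 2 := tsum_mul_left
    _ ≤ 9 / 2 * (1 / ρ) := by gcongr
    _ = _ := by ring

lemma abs_sub_le_of_abs_cube_sub_cube_le {x y D : ℝ} (hx : 0 < x) (hy : 0 < y)
    (h : |y ^ 3 - x ^ 3| ≤ D * y) : |y - x| ≤ D / x := by
  rw [le_div_iff₀ hx]
  refine le_of_mul_le_mul_right ?_ hy
  calc |y - x| * x * y ≤ |y - x| * (y ^ 2 + y * x + x ^ 2) := by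
        rw [mul_assoc]; gcongr; nlinarith
    _ = |y ^ 3 - x ^ 3| := by
        nth_rw 1 [← abs_of_pos (by positivity : 0 < y ^ 2 + y * x + x ^ 2)]
        rw [← abs_mul]
        congr 1
        ring
    _ ≤ _ := h

/- STATEMENT 8 (Equation (4.22)): fix r ≥ 1 and for each n ≥ 1 let ρ₀(n) be the
(unique) positive real number with n = r Σ_{m≥1} m² e^{−ρ₀m}/(1−e^{−ρ₀m}).
Then ρ₀(n)^{−1} = n^{1/3}/(2rζ(3))^{1/3} + O(n^{−1/3}) as n → ∞.  The summation
index m is shifted so that `m : ℕ` corresponds to m+1 ≥ 1. -/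
theorem saddle_point_asymptotics (r : ℕ) (hr : 1 ≤ r) (ρ₀ : ℕ → ℝ)
    (hpos : ∀ n : ℕ, 1 ≤ n → 0 < ρ₀ n)
    (heq : ∀ n : ℕ, 1 ≤ n →
      (n : ℝ) = r * ∑' m : ℕ,
        ((m : ℝ) + 1) ^ 2 * Real.exp (-(ρ₀ n) * ((m : ℝ) + 1)) /
          (1 - Real.exp (-(ρ₀ n) * ((m : ℝ) + 1)))) :
    ∃ C : ℝ, ∀ n : ℕ, 1 ≤ n →
      |(ρ₀ n)⁻¹ - (n : ℝ) ^ ((1 : ℝ) / 3) / (2 * r * zeta3) ^ ((1 : ℝ) / 3)|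
        ≤ C * (n : ℝ) ^ (-(1 : ℝ) / 3) := by
  have hr0 : (0 : ℝ) < r := by exact_mod_cast hr
  have hA : 0 < 2 * r * zeta3 := by have := zeta3_pos; positivity
  refine ⟨9 / 2 * r / (2 * r * zeta3) * (2 * r * zeta3) ^ ((1 : ℝ) / 3), fun n hn => ?_⟩
  have hn0 : (0 : ℝ) < n := by exact_mod_cast hn
  have hρ := hpos n hn
  have hcube : ∀ z : ℝ, 0 < z → (z ^ ((1 : ℝ) / 3)) ^ 3 = z := fun z hz => by
    rw [← Real.rpow_natCast, ← Real.rpow_mul hz.le]; norm_num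
  have hF := abs_tsum_sq_mul_exp_div_sub_le hρ
  have hn_eq := heq n hn
  set F := ∑' m : ℕ, ((m : ℝ) + 1) ^ 2 * Real.exp (-(ρ₀ n) * ((m : ℝ) + 1)) /
    (1 - Real.exp (-(ρ₀ n) * ((m : ℝ) + 1)))
  have hxy : |(ρ₀ n)⁻¹ ^ 3 - ((n : ℝ) ^ ((1 : ℝ) / 3) / (2 * r * zeta3) ^ ((1 : ℝ) / 3)) ^ 3|
      ≤ 9 / 2 * r / (2 * r * zeta3) * (ρ₀ n)⁻¹ := by
    rw [div_pow, hcube _ hn0, hcube _ hA, abs_sub_comm]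
    have hz := zeta3_pos.ne'
    have e : (n : ℝ) / (2 * r * zeta3) - (ρ₀ n)⁻¹ ^ 3
        = r / (2 * r * zeta3) * (F - 2 * zeta3 / ρ₀ n ^ 3) := by
      rw [hn_eq]; field_simp
    rw [e, abs_mul, abs_of_pos (by positivity : 0 < r / (2 * r * zeta3))]
    calc _ ≤ r / (2 * r * zeta3) * (9 / 2 / ρ₀ n) := by gcongr
      _ = _ := by ring
  refine (abs_sub_le_of_abs_cube_sub_cube_le (by positivity) (by positivity) hxy).trans_eq ?_
  rw [neg_div, Real.rpow_neg hn0.le, div_div_eq_mul_div, div_eq_mul_inv _ ((n : ℝ) ^ _)]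
end

section
/- Fix an integer r ≥ 1 and real numbers α, β, γ. As ρ → 0⁺ one has −(r/2) Σ_{m=1}^{∞} ( (α + (r+1)β) m³ + (α + 2γ) m² ) · e^{−ρm}/(1 − e^{−ρm})² = −3rζ(3)(α + (r+1)β) ρ^{−4} − rζ(2)(α + 2γ) ρ^{−3} + O(ρ^{−2}). -/
open Filter Set

/-- ζ(2) = π²/6. -/
noncomputable def zeta2 : ℝ := ∑' k : ℕ, 1 / ((k : ℝ) + 1) ^ 2

/-- The telescoping majorant used to control the remainder series. -/
lemma sum_range_inv_mul_le {ρ : ℝ} (hρ : 0 < ρ) (n : ℕ) :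
    ∑ k ∈ Finset.range n, 1 / ((1 + ρ * (k + 1)) * (1 + ρ * (k + 1) + ρ)) ≤ 1 / ρ := by
  have key : ∀ k : ℕ, 1 / ((1 + ρ * ((k : ℝ) + 1)) * (1 + ρ * (k + 1) + ρ)) =
      1 / ρ * (1 / (1 + ρ * ((k : ℝ) + 1))) - 1 / ρ * (1 / (1 + ρ * (((k + 1 : ℕ) : ℝ) + 1))) := by
    intro k
    have h1 : 0 < 1 + ρ * ((k : ℝ) + 1) := by positivity
    have h2 : 0 < 1 + ρ * ((k : ℝ) + 1) + ρ := by positivity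
    have h3 : 1 + ρ * (((k + 1 : ℕ) : ℝ) + 1) = 1 + ρ * ((k : ℝ) + 1) + ρ := by push_cast; ring
    rw [h3]
    field_simp
    ring
  simp_rw [key]
  rw [Finset.sum_range_sub' (fun k : ℕ ↦ 1 / ρ * (1 / (1 + ρ * ((k : ℝ) + 1))))]
  have h1 : 1 / ρ * (1 / (1 + ρ * (((0 : ℕ) : ℝ) + 1))) ≤ 1 / ρ * 1 := by
    gcongr
    rw [div_le_one (by positivity)]
    simp [hρ.le]
  have h2 : 0 ≤ 1 / ρ * (1 / (1 + ρ * ((n : ℝ) + 1))) := by positivity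
  linarith

/-- A function on the positive reals that is bounded and `O(t⁻³)` satisfies
`∑ k * E (ρ k) = O(ρ⁻²)`. -/
lemma summable_and_abs_tsum_le {E : ℝ → ℝ} {D ρ : ℝ} (hρ : 0 < ρ) (hρ1 : ρ < 1)
    (hE : ∀ t > 0, |E t| ≤ D) (hE3 : ∀ t ≥ 1, |E t| * t ^ 3 ≤ D) :
    Summable (fun k : ℕ ↦ ((k : ℝ) + 1) * E (ρ * (k + 1))) ∧
      |∑' k : ℕ, ((k : ℝ) + 1) * E (ρ * (k + 1))| ≤ 6 * D * ρ ^ (-2 : ℤ) := by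
  have hD : 0 ≤ D := (abs_nonneg _).trans (hE 1 one_pos)
  have hpt : ∀ t > 0, |E t| * (t * ((1 + t) * (1 + t + ρ))) ≤ 6 * D := by
    intro t ht
    rcases le_total t 1 with h | h
    · have : t * ((1 + t) * (1 + t + ρ)) ≤ 1 * ((1 + 1) * (1 + 1 + 1)) := by gcongr
      calc _ ≤ D * (1 * ((1 + 1) * (1 + 1 + 1))) := by gcongr; exact hE t ht
        _ = _ := by ring
    · have : t * ((1 + t) * (1 + t + ρ)) ≤ t * ((t + t) * (t + t + t)) := by gcongr; linarith
      calc _ ≤ |E t| * (t * ((t + t) * (t + t + t))) := by gcongr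
        _ = 6 * (|E t| * t ^ 3) := by ring
        _ ≤ _ := by gcongr; exact hE3 t h
  have hterm : ∀ k : ℕ, |((k : ℝ) + 1) * E (ρ * (k + 1))| ≤
      6 * D / ρ * (1 / ((1 + ρ * (k + 1)) * (1 + ρ * (k + 1) + ρ))) := by
    intro k
    have h := hpt (ρ * (k + 1)) (by positivity)
    rw [abs_mul, abs_of_pos (by positivity : (0 : ℝ) < k + 1), mul_one_div, le_div_iff₀ (by positivity),
      le_div_iff₀ hρ]
    linarith
  have hsum : ∀ n : ℕ, ∑ k ∈ Finset.range n, |((k : ℝ) + 1) * E (ρ * (k + 1))| ≤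
      6 * D * ρ ^ (-2 : ℤ) := by
    intro n
    calc _ ≤ ∑ k ∈ Finset.range n,
          6 * D / ρ * (1 / ((1 + ρ * ((k : ℝ) + 1)) * (1 + ρ * (k + 1) + ρ))) :=
          Finset.sum_le_sum fun k _ ↦ hterm k
      _ ≤ 6 * D / ρ * (1 / ρ) := by
          rw [← Finset.mul_sum]
          gcongr
          exact sum_range_inv_mul_le hρ n
      _ = _ := by
          rw [zpow_neg]
          norm_cast
          field_simp
  have hs := summable_of_sum_range_le (fun _ ↦ abs_nonneg _) hsum
  refine ⟨hs.of_abs, ?_⟩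
  have h1 : |∑' k : ℕ, ((k : ℝ) + 1) * E (ρ * (k + 1))| ≤
      ∑' k : ℕ, |((k : ℝ) + 1) * E (ρ * (k + 1))| := by
    simpa only [Real.norm_eq_abs] using norm_tsum_le_tsum_norm hs.of_abs.norm
  exact h1.trans (Real.tsum_le_of_sum_range_le (fun _ ↦ abs_nonneg _) hsum)

/-- Asymptotics of `∑ m ^ p * e^{-ρm} / (1 - e^{-ρm})²`, given the behaviour of
`S t = ∑ m ^ p * e^{-tm}`. -/
lemma exists_hasSum_lambert {S : ℝ → ℝ} {p : ℕ} {c D ρ : ℝ} (hp : 2 ≤ p)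
    (hρ : 0 < ρ) (hρ1 : ρ < 1)
    (hS : ∀ t > 0, HasSum (fun m : ℕ ↦ ((m : ℝ) + 1) ^ p * Real.exp (-t * (m + 1))) (S t))
    (hE : ∀ t > 0, |S t - c / t ^ (p + 1)| ≤ D)
    (hE3 : ∀ t ≥ 1, |S t - c / t ^ (p + 1)| * t ^ 3 ≤ D) :
    ∃ V, HasSum (fun m : ℕ ↦ ((m : ℝ) + 1) ^ p * Real.exp (-ρ * (m + 1)) /
        (1 - Real.exp (-ρ * (m + 1))) ^ 2) V ∧
      |V - c * (∑' k : ℕ, 1 / ((k : ℝ) + 1) ^ p) / ρ ^ (p + 1)| ≤ 6 * D * ρ ^ (-2 : ℤ) := by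
  obtain ⟨hs, hb⟩ := summable_and_abs_tsum_le (E := fun t ↦ S t - c / t ^ (p + 1)) hρ hρ1 hE hE3
  have hz : Summable (fun k : ℕ ↦ 1 / ((k : ℝ) + 1) ^ p) := by
    have := (summable_nat_add_iff 1).2 (Real.summable_one_div_nat_pow.2 (by lia : 1 < p))
    simpa using this
  have hsplit : ∀ k : ℕ, ((k : ℝ) + 1) * S (ρ * (k + 1)) =
      ((k : ℝ) + 1) * (S (ρ * (k + 1)) - c / (ρ * (k + 1)) ^ (p + 1)) +
        c / ρ ^ (p + 1) * (1 / ((k : ℝ) + 1) ^ p) := by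
    intro k
    have : (0 : ℝ) < k + 1 := by positivity
    rw [mul_pow]
    generalize S (ρ * (k + 1)) = s
    field_simp
    ring
  have hV := hs.hasSum.add (hz.hasSum.mul_left (c / ρ ^ (p + 1)))
  simp_rw [← hsplit] at hV
  set f : ℕ × ℕ → ℝ := fun q ↦
    ((q.1 : ℝ) + 1) * (((q.2 : ℝ) + 1) ^ p * Real.exp (-(ρ * (q.1 + 1)) * (q.2 + 1))) with hf
  have hrow : ∀ k : ℕ, HasSum (fun m ↦ f (k, m)) (((k : ℝ) + 1) * S (ρ * (k + 1))) := fun k ↦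
    (hS (ρ * (k + 1)) (by positivity)).mul_left _
  have hfs : Summable f := by
    rw [summable_prod_of_nonneg (fun q ↦ by simp only [hf]; positivity)]
    refine ⟨fun k ↦ (hrow k).summable, ?_⟩
    simp_rw [fun k ↦ (hrow k).tsum_eq]
    exact hV.summable
  have hfV := hfs.hasSum
  rw [(hfV.prod_fiberwise hrow).unique hV, ← (Equiv.prodComm ℕ ℕ).hasSum_iff] at hfV
  refine ⟨_, hfV.prod_fiberwise fun m ↦ ?_, ?_⟩
  · have hy : ‖Real.exp (-ρ * ((m : ℝ) + 1))‖ < 1 := by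
      rw [Real.norm_eq_abs, abs_of_pos (Real.exp_pos _), Real.exp_lt_one_iff]
      have : 0 < ρ * ((m : ℝ) + 1) := by positivity
      linarith
    have h := (hasSum_choose_mul_geometric_of_norm_lt_one 1 hy).mul_left
      (((m : ℝ) + 1) ^ p * Real.exp (-ρ * (m + 1)))
    rw [mul_one_div] at h
    refine h.congr_fun fun k ↦ ?_
    have he : Real.exp (-(ρ * ((k : ℝ) + 1)) * (m + 1)) =
        Real.exp (-ρ * (m + 1)) * Real.exp (-ρ * (m + 1)) ^ k := by
      rw [← Real.exp_nat_mul, ← Real.exp_add]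
      ring_nf
    simp only [hf, Function.comp, Equiv.prodComm_apply, Prod.swap, he, Nat.choose_one_right]
    push_cast
    ring
  · convert hb using 2
    ring

/-- Laurent expansion of `1 / (1 - e^{-t})` at zero, up to an error `O(t³)`. -/
lemma exists_inv_one_sub_exp_neg_eq {t : ℝ} (ht : 0 < t) (ht1 : t ≤ 1) :
    ∃ η : ℝ, |η| ≤ 1 ∧ 1 / (1 - Real.exp (-t)) = 1 / 2 + 1 / t + t * (1 / 12 + η * t ^ 2) := by
  have hR := Real.exp_bound (x := t) (by rwa [abs_of_pos ht]) (n := 5) (by norm_num)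
  rw [abs_of_pos ht] at hR
  norm_num [Finset.sum_range_succ, Nat.factorial] at hR
  have hE : t < Real.exp t - 1 := by linarith [Real.add_one_lt_exp ht.ne']
  have hE0 : 0 < Real.exp t - 1 := ht.trans hE
  refine ⟨(1 / (1 - Real.exp (-t)) - 1 / 2 - 1 / t - t / 12) / t ^ 3, ?_, by field_simp; ring⟩
  have hv : 1 / (1 - Real.exp (-t)) = Real.exp t / (Real.exp t - 1) := by
    rw [Real.exp_neg]
    have := Real.exp_pos t
    field_simp
  rw [hv]
  generalize Real.exp t = E at *
  have hN : (E / (E - 1) - 1 / 2 - 1 / t - t / 12) / t ^ 3 =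
      (6 * t * (E + 1) - 12 * (E - 1) - t ^ 2 * (E - 1)) / (12 * t ^ 4 * (E - 1)) := by
    field_simp
    ring
  rw [hN, abs_div, abs_of_pos (by positivity : 0 < 12 * t ^ 4 * (E - 1)), div_le_one (by positivity)]
  set R := E - (1 + t + t ^ 2 / 2 + t ^ 3 / 6 + t ^ 4 / 24) with hRdef
  have hR' : |R| ≤ t ^ 5 / 2 := by
    refine hR.trans ?_
    have : 0 < t ^ 5 := by positivity
    linarith
  have hnum : 6 * t * (E + 1) - 12 * (E - 1) - t ^ 2 * (E - 1) =
      t ^ 5 * (1 / 12 - t / 24) + R * (6 * t - 12 - t ^ 2) := by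
    rw [hRdef]
    ring
  rw [hnum]
  have h1 : |1 / 12 - t / 24| ≤ 1 / 12 := by rw [abs_le]; constructor <;> linarith
  have h2 : |6 * t - 12 - t ^ 2| ≤ 12 := by rw [abs_le]; constructor <;> nlinarith
  calc _ ≤ t ^ 5 * |1 / 12 - t / 24| + |R| * |6 * t - 12 - t ^ 2| := by
        refine (abs_add_le _ _).trans_eq ?_
        rw [abs_mul, abs_mul, abs_of_pos (by positivity : 0 < t ^ 5)]
    _ ≤ t ^ 5 * (1 / 12) + t ^ 5 / 2 * 12 := by gcongr
    _ ≤ 12 * t ^ 4 * t := by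
        have : 0 < t ^ 5 := by positivity
        linarith
    _ ≤ 12 * t ^ 4 * (E - 1) := by gcongr

/-- For `t ≥ 1`, `1 / (1 - e^{-t})` is at most `1 + min 1 (6 / t³)`, and exceeds `1`. -/
lemma inv_one_sub_exp_neg_bounds {t : ℝ} (ht : 1 ≤ t) :
    ∃ w : ℝ, 0 < w ∧ w ≤ 1 ∧ w * t ^ 3 ≤ 6 ∧ 1 / (1 - Real.exp (-t)) = 1 + w := by
  have ht0 : 0 < t := by linarith
  have h1 : t < Real.exp t - 1 := by linarith [Real.add_one_lt_exp ht0.ne']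
  have h3 := Real.sum_le_exp_of_nonneg ht0.le 4
  norm_num [Finset.sum_range_succ, Nat.factorial] at h3
  refine ⟨1 / (Real.exp t - 1), by apply one_div_pos.2; linarith, ?_, ?_, ?_⟩
  · rw [div_le_one] <;> linarith
  · rw [one_div_mul_eq_div, div_le_iff₀ (by linarith)]
    nlinarith
  · have := Real.exp_pos t
    have : 0 < Real.exp t - 1 := by linarith
    rw [Real.exp_neg]
    field_simp
    ring

lemma exp_neg_mul_add_one (t : ℝ) (m : ℕ) :
    Real.exp (-t * (m + 1)) = Real.exp (-t) * Real.exp (-t) ^ m := by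
  rw [← Real.exp_nat_mul, ← Real.exp_add]
  ring_nf

/-- Closed form of `∑ m² e^{-tm}` in terms of `v = 1 / (1 - e^{-t})`. -/
lemma hasSum_sq_mul_exp {t v : ℝ} (ht : 0 < t) (hv : 1 / (1 - Real.exp (-t)) = v) :
    HasSum (fun m : ℕ ↦ ((m : ℝ) + 1) ^ 2 * Real.exp (-t * (m + 1)))
      (2 * v ^ 3 - 3 * v ^ 2 + v) := by
  have hx1 : Real.exp (-t) < 1 := Real.exp_lt_one_iff.2 (by linarith)
  have hx : ‖Real.exp (-t)‖ < 1 := by rwa [Real.norm_eq_abs, abs_of_pos (Real.exp_pos _)]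
  have h := (((hasSum_choose_mul_geometric_of_norm_lt_one 2 hx).mul_left 2).sub
    (hasSum_choose_mul_geometric_of_norm_lt_one 1 hx)).mul_left (Real.exp (-t))
  have hval : 2 * v ^ 3 - 3 * v ^ 2 + v =
      Real.exp (-t) * (2 * (1 / (1 - Real.exp (-t)) ^ (2 + 1)) - 1 / (1 - Real.exp (-t)) ^ (1 + 1)) := by
    have : 1 - Real.exp (-t) ≠ 0 := by linarith
    rw [← hv]
    field_simp
    ring
  rw [hval]
  refine h.congr_fun fun m ↦ ?_
  rw [exp_neg_mul_add_one, Nat.cast_choose_two, Nat.choose_one_right]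
  push_cast
  ring

/-- Closed form of `∑ m³ e^{-tm}` in terms of `v = 1 / (1 - e^{-t})`. -/
lemma hasSum_cube_mul_exp {t v : ℝ} (ht : 0 < t) (hv : 1 / (1 - Real.exp (-t)) = v) :
    HasSum (fun m : ℕ ↦ ((m : ℝ) + 1) ^ 3 * Real.exp (-t * (m + 1)))
      (6 * v ^ 4 - 12 * v ^ 3 + 7 * v ^ 2 - v) := by
  have hx1 : Real.exp (-t) < 1 := Real.exp_lt_one_iff.2 (by linarith)
  have hx : ‖Real.exp (-t)‖ < 1 := by rwa [Real.norm_eq_abs, abs_of_pos (Real.exp_pos _)]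
  have h := ((((hasSum_choose_mul_geometric_of_norm_lt_one 3 hx).mul_left 6).sub
    ((hasSum_choose_mul_geometric_of_norm_lt_one 2 hx).mul_left 6)).add
    (hasSum_choose_mul_geometric_of_norm_lt_one 1 hx)).mul_left (Real.exp (-t))
  have hval : 6 * v ^ 4 - 12 * v ^ 3 + 7 * v ^ 2 - v =
      Real.exp (-t) * (6 * (1 / (1 - Real.exp (-t)) ^ (3 + 1)) -
        6 * (1 / (1 - Real.exp (-t)) ^ (2 + 1)) + 1 / (1 - Real.exp (-t)) ^ (1 + 1)) := by
    have : 1 - Real.exp (-t) ≠ 0 := by linarith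
    rw [← hv]
    field_simp
    ring
  rw [hval]
  refine h.congr_fun fun m ↦ ?_
  have h3 : ((Nat.choose (m + 3) 3 : ℕ) : ℝ) = ((m : ℝ) + 3) * (m + 2) * (m + 1) / 6 := by
    rw [Nat.cast_choose_eq_ascPochhammer_div]
    simp [ascPochhammer_succ_left, Nat.factorial]
    ring
  rw [exp_neg_mul_add_one, h3, Nat.cast_choose_two, Nat.choose_one_right]
  push_cast
  ring

/-- Approximation of `∑ m² e^{-tm}` by `2 / t³`. -/
lemma abs_sq_closed_form_sub_le {t v : ℝ} (ht : 0 < t) (hv : 1 / (1 - Real.exp (-t)) = v) :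
    |2 * v ^ 3 - 3 * v ^ 2 + v - 2 / t ^ 3| ≤ 100 ∧
      (1 ≤ t → |2 * v ^ 3 - 3 * v ^ 2 + v - 2 / t ^ 3| * t ^ 3 ≤ 100) := by
  have hlarge : 1 ≤ t → |2 * v ^ 3 - 3 * v ^ 2 + v - 2 / t ^ 3| * t ^ 3 ≤ 100 := by
    intro h
    obtain ⟨w, hw, hw1, hw3, hvw⟩ := inv_one_sub_exp_neg_bounds h
    obtain rfl : v = 1 + w := hv.symm.trans hvw
    have habs (y : ℝ) : |y| * t ^ 3 = |y * t ^ 3| := by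
      rw [abs_mul, abs_of_pos (by positivity : 0 < t ^ 3)]
    have e : (2 * (1 + w) ^ 3 - 3 * (1 + w) ^ 2 + (1 + w) - 2 / t ^ 3) * t ^ 3 =
        w * t ^ 3 * ((1 + w) * (1 + 2 * w)) - 2 := by
      field_simp
      ring
    rw [habs, e, abs_le]
    have h1 : w * t ^ 3 * ((1 + w) * (1 + 2 * w)) ≤ 6 * ((1 + 1) * (1 + 2 * 1)) := by gcongr
    have h2 : 0 ≤ w * t ^ 3 * ((1 + w) * (1 + 2 * w)) := by positivity
    constructor <;> linarith
  refine ⟨?_, hlarge⟩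
  rcases le_total 1 t with h | h
  · exact (le_mul_of_one_le_right (abs_nonneg _) (one_le_pow₀ h)).trans (hlarge h)
  obtain ⟨η, hη, hvη⟩ := exists_inv_one_sub_exp_neg_eq ht h
  rw [hv] at hvη
  obtain ⟨z, hz⟩ : ∃ z, z = 1 / 12 + η * t ^ 2 := ⟨_, rfl⟩
  have hat : |t| ≤ 1 := by rwa [abs_of_pos ht]
  have hz2 : |z| ≤ 2 := by
    rw [hz]
    calc _ ≤ |1 / 12| + |η| * |t| ^ 2 := by
          rw [← abs_pow, ← abs_mul]
          exact abs_add_le _ _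
      _ ≤ |1 / 12| + 1 * 1 ^ 2 := by gcongr
      _ ≤ 2 := by norm_num
  have e : 2 * v ^ 3 - 3 * v ^ 2 + v - 2 / t ^ 3 =
      6 * η * t + 6 * t * z ^ 2 + 2 * t ^ 3 * z ^ 3 - t * z / 2 := by
    rw [hvη, hz]
    field_simp
    ring
  rw [e]
  calc _ ≤ 6 * |η| * |t| + 6 * |t| * |z| ^ 2 + 2 * |t| ^ 3 * |z| ^ 3 + |t| * |z| / 2 := by
        refine (abs_sub _ _).trans ?_
        gcongr ?_ + ?_
        · refine (abs_add_three _ _ _).trans_eq ?_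
          simp [abs_mul, abs_pow]
        · simp [abs_mul, abs_div]
    _ ≤ 6 * 1 * 1 + 6 * 1 * 2 ^ 2 + 2 * 1 ^ 3 * 2 ^ 3 + 1 * 2 / 2 := by gcongr
    _ ≤ 100 := by norm_num

/-- Approximation of `∑ m³ e^{-tm}` by `6 / t⁴`. -/
lemma abs_cube_closed_form_sub_le {t v : ℝ} (ht : 0 < t) (hv : 1 / (1 - Real.exp (-t)) = v) :
    |6 * v ^ 4 - 12 * v ^ 3 + 7 * v ^ 2 - v - 6 / t ^ 4| ≤ 1000 ∧
      (1 ≤ t → |6 * v ^ 4 - 12 * v ^ 3 + 7 * v ^ 2 - v - 6 / t ^ 4| * t ^ 3 ≤ 1000) := by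
  have hlarge : 1 ≤ t → |6 * v ^ 4 - 12 * v ^ 3 + 7 * v ^ 2 - v - 6 / t ^ 4| * t ^ 3 ≤ 1000 := by
    intro h
    obtain ⟨w, hw, hw1, hw3, hvw⟩ := inv_one_sub_exp_neg_bounds h
    obtain rfl : v = 1 + w := hv.symm.trans hvw
    have habs (y : ℝ) : |y| * t ^ 3 = |y * t ^ 3| := by
      rw [abs_mul, abs_of_pos (by positivity : 0 < t ^ 3)]
    have e : (6 * (1 + w) ^ 4 - 12 * (1 + w) ^ 3 + 7 * (1 + w) ^ 2 - (1 + w) - 6 / t ^ 4) * t ^ 3 =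
        w * t ^ 3 * ((1 + w) * (1 + 6 * w + 6 * w ^ 2)) - 6 / t := by
      field_simp
      ring
    rw [habs, e, abs_le]
    have h1 : w * t ^ 3 * ((1 + w) * (1 + 6 * w + 6 * w ^ 2)) ≤
        6 * ((1 + 1) * (1 + 6 * 1 + 6 * 1 ^ 2)) := by gcongr
    have h2 : 0 ≤ w * t ^ 3 * ((1 + w) * (1 + 6 * w + 6 * w ^ 2)) := by positivity
    have h3 : 6 / t ≤ 6 := div_le_self (by norm_num) h
    have h4 : 0 ≤ 6 / t := by positivity
    constructor <;> linarith
  refine ⟨?_, hlarge⟩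
  rcases le_total 1 t with h | h
  · exact (le_mul_of_one_le_right (abs_nonneg _) (one_le_pow₀ h)).trans (hlarge h)
  obtain ⟨η, hη, hvη⟩ := exists_inv_one_sub_exp_neg_eq ht h
  rw [hv] at hvη
  obtain ⟨z, hz⟩ : ∃ z, z = 1 / 12 + η * t ^ 2 := ⟨_, rfl⟩
  have hat : |t| ≤ 1 := by rwa [abs_of_pos ht]
  have hz2 : |z| ≤ 2 := by
    rw [hz]
    calc _ ≤ |1 / 12| + |η| * |t| ^ 2 := by
          rw [← abs_pow, ← abs_mul]
          exact abs_add_le _ _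
      _ ≤ |1 / 12| + 1 * 1 ^ 2 := by gcongr
      _ ≤ 2 := by norm_num
  have e : 6 * v ^ 4 - 12 * v ^ 3 + 7 * v ^ 2 - v - 6 / t ^ 4 =
      (24 * η + 36 * z ^ 2 + 24 * t ^ 2 * z ^ 3) + (6 * t ^ 4 * z ^ 4 + 1 / 8)
        - (4 * z + 2 * t ^ 2 * z ^ 2) := by
    rw [hvη, hz]
    field_simp
    ring
  rw [e]
  calc _ ≤ (24 * |η| + 36 * |z| ^ 2 + 24 * |t| ^ 2 * |z| ^ 3) + (6 * |t| ^ 4 * |z| ^ 4 + 1 / 8)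
        + (4 * |z| + 2 * |t| ^ 2 * |z| ^ 2) := by
        refine (abs_sub _ _).trans ?_
        gcongr ?_ + ?_
        · refine (abs_add_le _ _).trans ?_
          gcongr ?_ + ?_
          · refine (abs_add_three _ _ _).trans_eq ?_
            simp [abs_mul]
          · refine (abs_add_le _ _).trans_eq ?_
            simp [abs_mul]
        · refine (abs_add_le _ _).trans_eq ?_
          simp [abs_mul]
    _ ≤ (24 * 1 + 36 * 2 ^ 2 + 24 * 1 ^ 2 * 2 ^ 3) + (6 * 1 ^ 4 * 2 ^ 4 + 1 / 8)
        + (4 * 2 + 2 * 1 ^ 2 * 2 ^ 2) := by gcongr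
    _ ≤ 1000 := by norm_num

/- STATEMENT 12 (Equation (4.20)): for r ≥ 1 and α, β, γ : ℝ, as ρ → 0⁺,
−(r/2) Σ_{m≥1} ((α+(r+1)β)m³ + (α+2γ)m²) e^{−ρm}/(1−e^{−ρm})²
  = −3rζ(3)(α+(r+1)β)ρ^{−4} − rζ(2)(α+2γ)ρ^{−3} + O(ρ^{−2}).
The summation index m is shifted so that `m : ℕ` corresponds to m+1 ≥ 1. -/
theorem gxy_asymptotics (r : ℕ) (hr : 1 ≤ r) (α β γ : ℝ) :
    ∃ C > (0 : ℝ), ∃ ρ₁ > (0 : ℝ), ∀ ρ ∈ Set.Ioo (0 : ℝ) ρ₁,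
      |(-(r : ℝ) / 2 * ∑' m : ℕ,
            ((α + (r + 1) * β) * ((m : ℝ) + 1) ^ 3 + (α + 2 * γ) * ((m : ℝ) + 1) ^ 2) *
              Real.exp (-ρ * ((m : ℝ) + 1)) / (1 - Real.exp (-ρ * ((m : ℝ) + 1))) ^ 2)
          - (-3 * r * zeta3 * (α + (r + 1) * β) * ρ ^ (-4 : ℤ)
              - r * zeta2 * (α + 2 * γ) * ρ ^ (-3 : ℤ))| ≤ C * ρ ^ (-2 : ℤ) := by
  set a := α + (r + 1) * β with ha
  set b := α + 2 * γ with hb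
  refine ⟨r / 2 * (|a| * 6000 + |b| * 600) + 1, by positivity, 1, one_pos, fun ρ hρ ↦ ?_⟩
  obtain ⟨V₃, hV₃, hb₃⟩ := exists_hasSum_lambert (p := 3) (by norm_num) hρ.1 hρ.2
    (fun t ht ↦ hasSum_cube_mul_exp ht rfl)
    (fun t ht ↦ (abs_cube_closed_form_sub_le ht rfl).1)
    (fun t ht ↦ (abs_cube_closed_form_sub_le (one_pos.trans_le ht) rfl).2 ht)
  obtain ⟨V₂, hV₂, hb₂⟩ := exists_hasSum_lambert (p := 2) (by norm_num) hρ.1 hρ.2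
    (fun t ht ↦ hasSum_sq_mul_exp ht rfl)
    (fun t ht ↦ (abs_sq_closed_form_sub_le ht rfl).1)
    (fun t ht ↦ (abs_sq_closed_form_sub_le (one_pos.trans_le ht) rfl).2 ht)
  have hsum : ∑' m : ℕ, (a * ((m : ℝ) + 1) ^ 3 + b * ((m : ℝ) + 1) ^ 2) *
      Real.exp (-ρ * ((m : ℝ) + 1)) / (1 - Real.exp (-ρ * ((m : ℝ) + 1))) ^ 2 =
      a * V₃ + b * V₂ := by
    rw [← ((hV₃.mul_left a).add (hV₂.mul_left b)).tsum_eq]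
    congr 1 with m
    ring
  rw [hsum]
  change |V₃ - 6 * zeta3 / ρ ^ 4| ≤ _ at hb₃
  change |V₂ - 2 * zeta2 / ρ ^ 3| ≤ _ at hb₂
  have e : -(r : ℝ) / 2 * (a * V₃ + b * V₂) -
      (-3 * r * zeta3 * a * ρ ^ (-4 : ℤ) - r * zeta2 * b * ρ ^ (-3 : ℤ)) =
      -(r / 2 * (a * (V₃ - 6 * zeta3 / ρ ^ 4) + b * (V₂ - 2 * zeta2 / ρ ^ 3))) := by
    have h4 : ρ ^ (-4 : ℤ) = (ρ ^ 4)⁻¹ := by rw [zpow_neg]; norm_cast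
    have h3 : ρ ^ (-3 : ℤ) = (ρ ^ 3)⁻¹ := by rw [zpow_neg]; norm_cast
    rw [h4, h3]
    ring
  have hpos : 0 < ρ ^ (-2 : ℤ) := zpow_pos hρ.1 _
  rw [e, abs_neg, abs_mul, abs_of_nonneg (by positivity : (0 : ℝ) ≤ r / 2)]
  calc _ ≤ (r : ℝ) / 2 * (|a| * (6 * 1000 * ρ ^ (-2 : ℤ)) + |b| * (6 * 100 * ρ ^ (-2 : ℤ))) := by
        gcongr
        refine (abs_add_le _ _).trans ?_
        rw [abs_mul, abs_mul]
        gcongr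
    _ ≤ _ := by linarith
end
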